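/- Let V₁ and V₂ be finite dimensional complex vector spaces and ν a partition of length at most dim V₁ · dim V₂. As a representation of GL(V₁) × GL(V₂) acting on V₁ ⊗ V₂ via (g₁,g₂)·(v₁⊗v₂) = g₁(v₁)⊗g₂(v₂), the Schur module S^ν(V₁ ⊗ V₂) decomposes as ⊕_{λ,μ} (S^λ V₁ ⊗ S^μ V₂)^{⊕ g_{λ,μ,ν}}, where g_{λ,μ,ν} are the Kronecker coefficients. -/

import Mathlib

open scoped BigOperators
open scoped Classical

/-- A partition: a finitely supported antitone sequence of natural numbers
(the parts, indexed from 0). -/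
def IsPartitionFun (f : ℕ →₀ ℕ) : Prop := ∀ ⦃i j : ℕ⦄, i ≤ j → f j ≤ f i

def Partition' : Type := {f : ℕ →₀ ℕ // IsPartitionFun f}

namespace Partition'

/-- The size `|λ|` of a partition. -/
def size (l : Partition') : ℕ := l.1.sum fun _ v => v

/-- The number of (nonzero) parts of a partition. -/
def plength (l : Partition') : ℕ := l.1.support.card

noncomputable instance : Add Partition' :=
  ⟨fun l m => ⟨l.1 + m.1, fun i j h => by
    simp only [Finsupp.add_apply]
    exact add_le_add (l.2 h) (m.2 h)⟩⟩

noncomputable instance : SMul ℕ Partition' :=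
  ⟨fun d l => ⟨d • l.1, fun i j h => by
    simp only [Finsupp.smul_apply, smul_eq_mul]
    exact Nat.mul_le_mul_left d (l.2 h)⟩⟩

/-- The one-row partition `(m)`. For `m = 0` this is the empty partition. -/
noncomputable def row (m : ℕ) : Partition' :=
  ⟨Finsupp.single 0 m, by
    intro i j h
    simp only [Finsupp.single_apply]
    split_ifs <;> omega⟩

/-- The two-row partition `(a, b)` (with `b ≤ a`). -/
noncomputable def twoRow (a b : ℕ) (hba : b ≤ a) : Partition' :=
  ⟨Finsupp.single 0 a + Finsupp.single 1 b, by
    intro i j h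
    simp only [Finsupp.add_apply, Finsupp.single_apply]
    split_ifs <;> omega⟩

/-- `youngCount n a g` is the number of fixed points of the permutation `g` acting on the
set of functions `Fin n → Fin n` whose fibre over `i` has exactly `a i` elements; i.e. the
value at `g` of the permutation character of `S_n` acting on cosets of the Young subgroup
attached to the composition `a`. It is `0` if some `a i` is negative. -/
noncomputable def youngCount (n : ℕ) (a : Fin n → ℤ) (g : Equiv.Perm (Fin n)) : ℤ :=
  if ∀ i, 0 ≤ a i then
    (Nat.card {f : Fin n → Fin n //
      f ∘ g = f ∧ ∀ i : Fin n, Nat.card {x : Fin n // f x = i} = (a i).toNat} : ℤ)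
  else 0

/-- The irreducible character of the symmetric group `S_n` attached to a partition `l`
of `n`, given by the Jacobi–Trudi determinantal formula
`χ_l = det (h_{l_i - i + j})` expanded over permutations, where `h`-products are the
permutation characters of Young subgroups. (When `size l ≠ n` this is not used.) -/
noncomputable def irrChar (n : ℕ) (l : Partition') (g : Equiv.Perm (Fin n)) : ℤ :=
  ∑ σ : Equiv.Perm (Fin n), (Equiv.Perm.sign σ : ℤ) *
    youngCount n (fun i => (l.1 i : ℤ) + ((σ i : ℕ) : ℤ) - (i : ℤ)) g

/-- The Kronecker coefficient `g_{λ,μ,ν}`: the multiplicity of the irreducible `S_n`-module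
`M_ν` in `M_λ ⊗ M_μ` (for `|λ| = |μ| = |ν| = n`), computed as the scalar product of
characters `(1/n!) ∑_{g ∈ S_n} χ_λ(g) χ_μ(g) χ_ν(g)`; it is `0` if the sizes differ. -/
noncomputable def kron (l m nu : Partition') : ℕ :=
  if size l = size nu ∧ size m = size nu then
    ((∑ g : Equiv.Perm (Fin (size nu)),
        irrChar (size nu) l g * irrChar (size nu) m g * irrChar (size nu) nu g) /
      (Nat.factorial (size nu) : ℤ)).toNat
  else 0

/-- The standard embedding `S_a × S_b ↪ S_{a+b}`. -/
def sumEmb {a b : ℕ} (g : Equiv.Perm (Fin a)) (h : Equiv.Perm (Fin b)) :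
    Equiv.Perm (Fin (a + b)) :=
  (Equiv.permCongr finSumFinEquiv) (Equiv.sumCongr g h)

/-- The Littlewood–Richardson coefficient `c_{λ,μ}^ν`: the multiplicity of `M_ν` in the
induction of `M_λ ⊠ M_μ` from `S_{|λ|} × S_{|μ|}` to `S_{|λ|+|μ|}`, computed by
Frobenius reciprocity as a scalar product of characters; it is `0` unless
`|ν| = |λ| + |μ|`. -/
noncomputable def lr (l m nu : Partition') : ℕ :=
  if size nu = size l + size m then
    ((∑ g : Equiv.Perm (Fin (size l)), ∑ h : Equiv.Perm (Fin (size m)),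
        irrChar (size l) l g * irrChar (size m) m h *
          irrChar (size l + size m) nu (sumEmb g h)) /
      ((Nat.factorial (size l) : ℤ) * (Nat.factorial (size m) : ℤ))).toNat
  else 0

/-- The Aguiar coefficient `a_{λ,μ}^ν`, defined by
`a_{λ,μ}^ν = Σ_{α,β,δ,η,ρ,τ} c_{α,β}^λ c_{η,ρ}^μ g_{β,η,δ} c_{α,δ}^τ c_{τ,ρ}^ν`. -/
noncomputable def aguiar (l m nu : Partition') : ℕ :=
  ∑ᶠ (α : Partition') (β : Partition') (δ : Partition') (η : Partition')
    (ρ : Partition') (τ : Partition'),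
    lr α β l * lr η ρ m * kron β η δ * lr α δ τ * lr τ ρ nu

end Partition'

open scoped TensorProduct DirectSum

namespace Partition'

/-- `partialSum l i` is the number of boxes in the first `i` rows of the Young diagram
of `l`. -/
noncomputable def partialSum (l : Partition') (i : ℕ) : ℕ := ∑ j ∈ Finset.range i, l.1 j

/-- The row containing the `t`-th box of the Young diagram of `l`, the boxes being numbered
`0, 1, …, |l| - 1` row by row (this is the canonical filling). -/
noncomputable def rowOf (l : Partition') (t : ℕ) : ℕ :=
  Nat.findGreatest (fun r => partialSum l r ≤ t) t

/-- The column containing the `t`-th box of the Young diagram of `l`. -/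
noncomputable def colOf (l : Partition') (t : ℕ) : ℕ := t - partialSum l (rowOf l t)

variable (R : Type*) [CommRing R]

/-- The action of a permutation `σ ∈ S_n` on the `n`-th tensor power of `M`, permuting
the tensor factors. -/
noncomputable def permAction (n : ℕ) (M : Type*) [AddCommGroup M] [Module R M]
    (σ : Equiv.Perm (Fin n)) :
    PiTensorProduct R (fun _ : Fin n => M) →ₗ[R] PiTensorProduct R (fun _ : Fin n => M) :=
  (PiTensorProduct.reindex R (fun _ : Fin n => M) σ).toLinearMap

/-- The Young symmetrizer of the canonical tableau of shape `l` (of size `n = |l|`),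
acting on the `n`-th tensor power of `M`: the sum over the column group of the signed
permutation action, composed with the sum over the row group of the permutation action. -/
noncomputable def youngSymmetrizer (l : Partition') (M : Type*) [AddCommGroup M]
    [Module R M] :
    PiTensorProduct R (fun _ : Fin (size l) => M) →ₗ[R]
      PiTensorProduct R (fun _ : Fin (size l) => M) :=
  (∑ σ ∈ Finset.univ.filter
      (fun σ : Equiv.Perm (Fin (size l)) =>
        ∀ t : Fin (size l), colOf l ((σ t : ℕ)) = colOf l (t : ℕ)),
      ((Equiv.Perm.sign σ : ℤ) : R) • permAction R (size l) M σ) ∘ₗ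
    (∑ σ ∈ Finset.univ.filter
      (fun σ : Equiv.Perm (Fin (size l)) =>
        ∀ t : Fin (size l), rowOf l ((σ t : ℕ)) = rowOf l (t : ℕ)),
      permAction R (size l) M σ)

/-- The Schur module `S^l M`: the image of the Young symmetrizer of shape `l` acting on
the `|l|`-th tensor power of `M`. -/
noncomputable def schur (l : Partition') (M : Type*) [AddCommGroup M] [Module R M] :
    Submodule R (PiTensorProduct R (fun _ : Fin (size l) => M)) :=
  LinearMap.range (youngSymmetrizer R l M)

/-- The action of an endomorphism `g` of `M` on the `n`-th tensor power of `M`. -/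
noncomputable def tpow (n : ℕ) {M : Type*} [AddCommGroup M] [Module R M] (g : M →ₗ[R] M) :
    PiTensorProduct R (fun _ : Fin n => M) →ₗ[R] PiTensorProduct R (fun _ : Fin n => M) :=
  PiTensorProduct.map (fun _ => g)

end Partition'

open scoped BigOperators
open scoped Classical
open scoped TensorProduct DirectSum

set_option linter.unusedSectionVars false

namespace KP

section GA
variable {G : Type} [Group G] [Fintype G]

/-- The group algebra. -/
abbrev GA (G : Type) [Group G] := MonoidAlgebra ℂ G

/-- Group element in the group algebra. -/
noncomputable def gof (g : G) : GA G := MonoidAlgebra.single g 1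

lemma gof_mul (g h : G) : gof (g * h) = gof g * gof h := by
  simp [gof, MonoidAlgebra.single_mul_single]

lemma gof_one : gof (1 : G) = 1 := rfl

lemma gof_mul_inv (g : G) : gof g * gof g⁻¹ = 1 := by
  rw [← gof_mul, mul_inv_cancel, gof_one]

lemma gof_inv_mul (g : G) : gof g⁻¹ * gof g = 1 := by
  rw [← gof_mul, inv_mul_cancel, gof_one]

/-- The coefficient of the identity. -/
noncomputable def tau : GA G →ₗ[ℂ] ℂ where
  toFun x := x.coeff 1
  map_add' x y := by simp
  map_smul' c x := by simp

lemma tau_gof (g : G) : tau (gof g) = if g = 1 then 1 else 0 := by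
  change (MonoidAlgebra.single g (1:ℂ)).coeff 1 = _
  simp [Finsupp.single_apply]

lemma coeff_eq (x : GA G) (g : G) : x.coeff g = tau (x * gof g⁻¹) := by
  change _ = (x * MonoidAlgebra.single g⁻¹ (1:ℂ)).coeff 1
  simp [MonoidAlgebra.coeff_mul_single_apply]

lemma expand (x : GA G) : x = ∑ g : G, tau (x * gof g⁻¹) • gof g := by
  apply MonoidAlgebra.coeff_injective
  ext h
  rw [MonoidAlgebra.coeff_sum]
  simp only [gof, MonoidAlgebra.coeff_smul, Finsupp.coe_finsetSum, Finset.sum_apply, MonoidAlgebra.coeff_single]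
  simp only [Finsupp.smul_apply, Finsupp.single_apply]
  simp only [smul_eq_mul, mul_ite, mul_one, mul_zero, Finset.sum_ite_eq', Finset.mem_univ, if_true]
  exact coeff_eq x h

lemma ext_gof {M : Type*} [AddCommMonoid M] [Module ℂ M] {f g : GA G →ₗ[ℂ] M}
    (h : ∀ a, f (gof a) = g (gof a)) : f = g := by
  refine LinearMap.ext fun x => ?_
  rw [expand x]
  simp [h]

lemma ind_gof {p : GA G → Prop} (h0 : ∀ g, p (gof g)) (hz : p 0) (ha : ∀ x y, p x → p y → p (x + y))
    (hs : ∀ (c : ℂ) x, p x → p (c • x)) (x : GA G) : p x := by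
  rw [expand x]
  exact Finset.sum_induction _ p ha hz (fun g _ => hs _ _ (h0 g))

lemma tau_comm (x y : GA G) : tau (x * y) = tau (y * x) := by
  induction x using ind_gof with
  | h0 g =>
    induction y using ind_gof with
    | h0 h =>
      rw [← gof_mul, ← gof_mul, tau_gof, tau_gof]
      have : g * h = 1 ↔ h * g = 1 := by
        rw [mul_eq_one_iff_eq_inv, mul_eq_one_iff_inv_eq, eq_comm]
      simp only [this]
    | hz => simp
    | ha x y hx hy => simp [mul_add, add_mul, hx, hy]
    | hs c x hx => simp [hx]
  | hz => simp
  | ha x y hx hy => simp [mul_add, add_mul, hx, hy]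
  | hs c x hx => simp [hx]

/-- expansion with inverse -/
lemma expand_inv (x : GA G) : x = ∑ g : G, tau (x * gof g) • gof g⁻¹ := by
  conv_lhs => rw [expand x]
  exact Fintype.sum_equiv (Equiv.inv G) _ _ (fun g => by simp)

/-- The bilinear character form. -/
noncomputable def ch (u : GA G) : GA G →ₗ[ℂ] ℂ :=
  ∑ h : G, tau ∘ₗ LinearMap.mulRight ℂ u ∘ₗ LinearMap.mulRight ℂ (gof h⁻¹) ∘ₗ
    LinearMap.mulLeft ℂ (gof h)

lemma ch_apply (u x : GA G) : ch u x = ∑ h : G, tau (gof h * x * gof h⁻¹ * u) := by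
  simp [ch]

lemma ch_comm (u x : GA G) : ch u x = ch x u := by
  rw [ch_apply, ch_apply]
  refine Fintype.sum_equiv (Equiv.inv G) _ _ (fun g => ?_)
  simp only [Equiv.inv_apply, inv_inv]
  rw [tau_comm]
  rw [show u * (gof g * x * gof g⁻¹) = (u * gof g * x) * gof g⁻¹ by simp [mul_assoc], tau_comm]
  simp [mul_assoc]

lemma ch_conj (u x : GA G) (g : G) : ch u (gof g * x * gof g⁻¹) = ch u x := by
  rw [ch_apply, ch_apply]
  refine Fintype.sum_equiv (Equiv.mulRight g) _ _ (fun h => ?_)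
  simp [gof_mul, mul_assoc]

lemma ch_mul_comm (u x y : GA G) : ch u (x * y) = ch u (y * x) := by
  induction x using ind_gof with
  | h0 g =>
    rw [← ch_conj u (y * gof g) g]
    rw [show gof g * (y * gof g) * gof g⁻¹ = gof g * y * (gof g * gof g⁻¹) by simp [mul_assoc],
      gof_mul_inv, mul_one]
  | hz => simp
  | ha x y hx hy => simp [mul_add, add_mul, hx, hy]
  | hs c x hx => simp [hx]

lemma ch_smul_left (c : ℂ) (u x : GA G) : ch (c • u) x = c * ch u x := by
  rw [ch_comm, map_smul, ch_comm]; rfl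

instance : FiniteDimensional ℂ (GA G) :=
  Module.Finite.of_surjective (MonoidAlgebra.coeffLinearEquiv ℂ (S := ℂ) (M := G)).symm.toLinearMap
    (LinearEquiv.surjective _)

/-- The basis of group elements -/
noncomputable def gbasis : Module.Basis G ℂ (GA G) :=
  Module.Basis.ofRepr (MonoidAlgebra.coeffLinearEquiv ℂ)

lemma gbasis_apply (g : G) : gbasis g = gof g := by
  rfl

lemma gbasis_repr (x : GA G) (g : G) : gbasis.repr x g = tau (x * gof g⁻¹) := by
  rw [← coeff_eq]; rfl

lemma trace_lr (x u : GA G) :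
    LinearMap.trace ℂ (GA G) (LinearMap.mulRight ℂ u ∘ₗ LinearMap.mulLeft ℂ x) = ch u x := by
  rw [LinearMap.trace_eq_matrix_trace ℂ gbasis, Matrix.trace, ch_apply]
  refine Fintype.sum_equiv (Equiv.inv G) _ _ (fun g => ?_)
  rw [Matrix.diag_apply, LinearMap.toMatrix_apply, gbasis_repr, gbasis_apply]
  simp only [Equiv.inv_apply, inv_inv, LinearMap.comp_apply, LinearMap.mulRight_apply,
    LinearMap.mulLeft_apply]
  rw [tau_comm]
  simp [mul_assoc]

/-- the key evaluation -/
lemma ch_eval (e u : GA G) (he : e * e = e) (θ : GA G →ₗ[ℂ] ℂ)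
    (hθ : ∀ x, e * x * u = θ x • e) : ch u e = θ e := by
  have : ∀ h : G, tau (gof h * e * gof h⁻¹ * u) = tau (e * gof h) * θ (gof h⁻¹) := by
    intro h
    have h1 : gof h * e * gof h⁻¹ * u = (gof h * e) * (e * gof h⁻¹ * u) := by
      conv_lhs => rw [← he]
      simp [mul_assoc]
    rw [h1, hθ, mul_smul_comm, map_smul, mul_assoc, he, tau_comm, smul_eq_mul, mul_comm]
  rw [ch_apply, Finset.sum_congr rfl (fun h _ => this h)]
  conv_rhs => rw [expand_inv e, map_sum]
  simp

/-- sum of product of class functions -/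
lemma ch_inner (f : GA G →ₗ[ℂ] ℂ) (hf : ∀ g x, f (gof g * x * gof g⁻¹) = f x) (v : GA G) :
    ∑ g : G, f (gof g) * ch v (gof g⁻¹) = (Fintype.card G : ℂ) * f v := by
  have h1 : ∀ h : G, ∑ g : G, f (gof g) * tau (gof h * gof g⁻¹ * gof h⁻¹ * v) = f v := by
    intro h
    rw [← hf h⁻¹ v, inv_inv]
    conv_rhs => rw [expand (gof h⁻¹ * v * gof h), map_sum]
    refine Finset.sum_congr rfl (fun g _ => ?_)
    rw [map_smul, smul_eq_mul, mul_comm, tau_comm, tau_comm _ (gof g⁻¹)]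
    congr 1
    rw [tau_comm, show gof h * gof g⁻¹ * gof h⁻¹ * v = gof h * (gof g⁻¹ * gof h⁻¹ * v) by simp [mul_assoc],
      tau_comm]
    simp [mul_assoc]
  simp_rw [ch_apply, Finset.mul_sum]
  rw [Finset.sum_comm]
  simp [h1]

end GA
end KP

open scoped BigOperators
open scoped Classical
open scoped TensorProduct DirectSum
set_option linter.unusedSectionVars false

namespace KP

section Young
variable {n : ℕ} {κ κ' : Type}

/-- The symmetric group. -/
abbrev Sn (n : ℕ) := Equiv.Perm (Fin n)

/-- stabilizer of a colouring -/
noncomputable def stabF (f : Fin n → κ) : Finset (Sn n) :=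
  Finset.univ.filter (fun σ : Sn n => ∀ t, f (σ t) = f t)

lemma mem_stabF {f : Fin n → κ} {σ : Sn n} : σ ∈ stabF f ↔ ∀ t, f (σ t) = f t := by
  simp [stabF]

lemma mul_mem_stabF {f : Fin n → κ} {σ τ : Sn n} (h : σ ∈ stabF f) (h' : τ ∈ stabF f) :
    σ * τ ∈ stabF f := by
  rw [mem_stabF] at *
  intro t
  rw [Equiv.Perm.mul_apply, h, h']

lemma inv_mem_stabF {f : Fin n → κ} {σ : Sn n} (h : σ ∈ stabF f) : σ⁻¹ ∈ stabF f := by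
  rw [mem_stabF] at *
  intro t
  have := h (σ⁻¹ t)
  simpa using this.symm

lemma one_mem_stabF {f : Fin n → κ} : (1 : Sn n) ∈ stabF f := by
  rw [mem_stabF]; simp

lemma swap_mem_stabF {f : Fin n → κ} {i j : Fin n} (h : f i = f j) : Equiv.swap i j ∈ stabF f := by
  rw [mem_stabF]
  intro t
  by_cases h1 : t = i
  · subst h1; simp [h]
  · by_cases h2 : t = j
    · subst h2; simp [h]
    · rw [Equiv.swap_apply_of_ne_of_ne h1 h2]

/-- sign as complex number -/
noncomputable def sg (σ : Sn n) : ℂ := ((Equiv.Perm.sign σ : ℤ) : ℂ)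

lemma sg_mul (σ τ : Sn n) : sg (σ * τ) = sg σ * sg τ := by
  simp [sg]

lemma sg_sq (σ : Sn n) : sg σ * sg σ = 1 := by
  rw [sg, ← Int.cast_mul, ← Units.val_mul]
  simp

lemma sg_inv (σ : Sn n) : sg σ⁻¹ = sg σ := by
  simp [sg]

/-- row symmetrizer -/
noncomputable def symA (f : Fin n → κ) : GA (Sn n) := ∑ σ ∈ stabF f, gof σ

/-- column antisymmetrizer -/
noncomputable def symB (f : Fin n → κ) : GA (Sn n) := ∑ σ ∈ stabF f, sg σ • gof σ

lemma gof_mul_symA {f : Fin n → κ} {p : Sn n} (hp : p ∈ stabF f) : gof p * symA f = symA f := by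
  rw [symA, Finset.mul_sum]
  refine Finset.sum_bij' (fun σ _ => p * σ) (fun σ _ => p⁻¹ * σ) ?_ ?_ ?_ ?_ ?_
  · intro a ha; exact mul_mem_stabF hp ha
  · intro a ha; exact mul_mem_stabF (inv_mem_stabF hp) ha
  · intro a _; simp
  · intro a _; simp
  · intro a _; rw [gof_mul]

lemma symA_mul_gof {f : Fin n → κ} {p : Sn n} (hp : p ∈ stabF f) : symA f * gof p = symA f := by
  rw [symA, Finset.sum_mul]
  refine Finset.sum_bij' (fun σ _ => σ * p) (fun σ _ => σ * p⁻¹) ?_ ?_ ?_ ?_ ?_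
  · intro a ha; exact mul_mem_stabF ha hp
  · intro a ha; exact mul_mem_stabF ha (inv_mem_stabF hp)
  · intro a _; simp
  · intro a _; simp
  · intro a _; rw [gof_mul]

lemma gof_mul_symB {f : Fin n → κ} {p : Sn n} (hp : p ∈ stabF f) :
    gof p * symB f = sg p • symB f := by
  rw [symB, Finset.mul_sum, Finset.smul_sum]
  refine Finset.sum_bij' (fun σ _ => p * σ) (fun σ _ => p⁻¹ * σ) ?_ ?_ ?_ ?_ ?_
  · intro a ha; exact mul_mem_stabF hp ha
  · intro a ha; exact mul_mem_stabF (inv_mem_stabF hp) ha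
  · intro a _; simp
  · intro a _; simp
  · intro a _; rw [gof_mul, mul_smul_comm, smul_smul, sg_mul, ← mul_assoc, sg_sq, one_mul]

lemma symB_mul_gof {f : Fin n → κ} {p : Sn n} (hp : p ∈ stabF f) :
    symB f * gof p = sg p • symB f := by
  rw [symB, Finset.sum_mul, Finset.smul_sum]
  refine Finset.sum_bij' (fun σ _ => σ * p) (fun σ _ => σ * p⁻¹) ?_ ?_ ?_ ?_ ?_
  · intro a ha; exact mul_mem_stabF ha hp
  · intro a ha; exact mul_mem_stabF ha (inv_mem_stabF hp)
  · intro a _; simp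
  · intro a _; simp
  · intro a _
    rw [gof_mul, smul_mul_assoc, smul_smul, sg_mul, mul_comm (sg a), ← mul_assoc, sg_sq, one_mul]

lemma symA_mul_self (f : Fin n → κ) : symA f * symA f = ((stabF f).card : ℂ) • symA f := by
  conv_lhs => lhs; rw [symA]
  rw [Finset.sum_mul, Finset.sum_congr rfl (fun p hp => gof_mul_symA hp)]
  simp [Nat.cast_smul_eq_nsmul]

lemma sg_swap {i j : Fin n} (h : i ≠ j) : sg (Equiv.swap i j) = -1 := by
  simp [sg, Equiv.Perm.sign_swap h]

lemma eq_zero_of_neg {x : GA (Sn n)} (h : x = (-1 : ℂ) • x) : x = 0 := by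
  have h2 : (2 : ℂ) • x = 0 := by
    rw [two_smul]
    nth_rewrite 1 [h]
    simp
  simpa using h2

lemma symB_gof_symA_zero {f : Fin n → κ} {c : Fin n → κ'} {g : Sn n} {i j : Fin n} (hij : i ≠ j)
    (hf : f i = f j) (hc : c (g i) = c (g j)) : symB c * gof g * symA f = 0 := by
  apply eq_zero_of_neg
  conv_lhs => rw [← gof_mul_symA (swap_mem_stabF hf)]
  have h1 : gof g * gof (Equiv.swap i j) = gof (Equiv.swap (g i) (g j)) * gof g := by
    rw [← gof_mul, ← gof_mul, Equiv.mul_swap_eq_swap_mul]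
  calc symB c * gof g * (gof (Equiv.swap i j) * symA f)
      = symB c * (gof g * gof (Equiv.swap i j)) * symA f := by simp only [mul_assoc]
    _ = (symB c * gof (Equiv.swap (g i) (g j))) * gof g * symA f := by rw [h1]; simp only [mul_assoc]
    _ = _ := by
      rw [symB_mul_gof (swap_mem_stabF hc), sg_swap (by simpa using hij)]
      simp

lemma symA_gof_symB_zero {f : Fin n → κ} {c : Fin n → κ'} {g : Sn n} {i j : Fin n} (hij : i ≠ j)
    (hf : f i = f j) (hc : c (g⁻¹ i) = c (g⁻¹ j)) : symA f * gof g * symB c = 0 := by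
  apply eq_zero_of_neg
  conv_lhs => rw [← symA_mul_gof (swap_mem_stabF hf)]
  have h1 : gof (Equiv.swap i j) * gof g = gof g * gof (Equiv.swap (g⁻¹ i) (g⁻¹ j)) := by
    rw [← gof_mul, ← gof_mul, Equiv.mul_swap_eq_swap_mul]; simp
  calc symA f * gof (Equiv.swap i j) * gof g * symB c
      = symA f * (gof (Equiv.swap i j) * gof g) * symB c := by simp only [mul_assoc]
    _ = symA f * gof g * (gof (Equiv.swap (g⁻¹ i) (g⁻¹ j)) * symB c) := by rw [h1]; simp only [mul_assoc]
    _ = _ := by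
      rw [gof_mul_symB (swap_mem_stabF hc), sg_swap (by simpa using hij)]
      simp

/-- A filling of a Young diagram, given by row and column indices. -/
structure Tab (n : ℕ) where
  row : Fin n → ℕ
  col : Fin n → ℕ
  inj : ∀ s t, row s = row t → col s = col t → s = t
  down : ∀ s r, r ≤ row s → ∃ t, row t = r ∧ col t = col s

namespace Tab
variable (T : Tab n)

lemma col_count {f : Fin n → ℕ} {d : Fin n → ℕ} (r c : ℕ)
    (hd : (Finset.univ.filter (fun t => d t = c)).card ≤ (Finset.univ.filter (fun t => T.col t = c)).card)
    (h : ∀ i j, f i = f j → d i = d j → i = j) :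
    (Finset.univ.filter (fun t => d t = c ∧ f t < r)).card ≤
      (Finset.univ.filter (fun t => T.col t = c ∧ T.row t < r)).card := by
  by_cases hx : ∃ s, T.col s = c ∧ r ≤ T.row s
  · obtain ⟨s, hs, hr⟩ := hx
    calc _ ≤ (Finset.range r).card := by
          apply Finset.card_le_card_of_injOn f
          · intro t ht; simp at ht ⊢; exact ht.2
          · intro t ht t' ht' hh
            simp at ht ht'
            exact h _ _ hh (by rw [ht.1, ht'.1])
      _ ≤ _ := by
          have : ∀ i : ℕ, i < r → ∃ t, T.row t = i ∧ T.col t = c := by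
            intro i hi
            obtain ⟨t, ht, ht'⟩ := T.down s i (by omega)
            exact ⟨t, ht, by rw [ht', hs]⟩
          apply Finset.card_le_card_of_surjOn T.row
          intro i hi
          simp at hi
          obtain ⟨t, ht, ht'⟩ := this i hi
          exact ⟨t, by simp; exact ⟨ht', by omega⟩, ht⟩
  · push Not at hx
    have : (Finset.univ.filter (fun t => T.col t = c ∧ T.row t < r)) =
        (Finset.univ.filter (fun t => T.col t = c)) := by
      ext t
      simp only [Finset.mem_filter, Finset.mem_univ, true_and, and_iff_left_iff_imp]
      exact hx t
    rw [this]
    refine le_trans (Finset.card_le_card ?_) hd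
    intro t; simp; tauto

lemma card_col_perm (g : Sn n) (c : ℕ) : (Finset.univ.filter (fun t => T.col (g t) = c)).card =
    (Finset.univ.filter (fun t => T.col t = c)).card := by
  apply Finset.card_bij (fun t _ => g t)
  · intro t; simp
  · intro t _ t' _; simp
  · intro t ht; exact ⟨g⁻¹ t, by simpa using ht, by simp⟩

lemma card_fiber_sum (p : Fin n → Prop) [DecidablePred p] (d : Fin n → ℕ) (N : ℕ) (hN : ∀ t, d t < N) :
    (Finset.univ.filter p).card =
      ∑ c ∈ Finset.range N, (Finset.univ.filter (fun t => d t = c ∧ p t)).card := by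
  rw [Finset.card_eq_sum_card_fiberwise (f := d) (t := Finset.range N)]
  · refine Finset.sum_congr rfl (fun c _ => ?_)
    congr 1
    ext t; simp; tauto
  · intro t _; simpa using hN t

lemma exists_bound (d : Fin n → ℕ) : ∃ N, ∀ t, d t < N := by
  refine ⟨(Finset.univ.sup d) + 1, fun t => ?_⟩
  have := Finset.le_sup (f := d) (Finset.mem_univ t)
  omega

/-- dominance -/
lemma dominance {f : Fin n → ℕ} {g : Sn n}
    (h : ∀ i j, f i = f j → T.col (g i) = T.col (g j) → i = j) (r : ℕ) :
    (Finset.univ.filter (fun t => f t < r)).card ≤ (Finset.univ.filter (fun t => T.row t < r)).card := by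
  obtain ⟨N, hN⟩ := exists_bound T.col
  rw [card_fiber_sum _ (fun t => T.col (g t)) N (fun t => hN _), card_fiber_sum _ T.col N hN]
  apply Finset.sum_le_sum
  intro c _
  exact T.col_count r c (T.card_col_perm g c).le h

lemma exists_box {g : Sn n}
    (h : ∀ i j, T.row i = T.row j → T.col (g i) = T.col (g j) → i = j) (t : Fin n) :
    ∃ s, T.row s = T.row t ∧ T.col s = T.col (g t) := by
  by_contra hcon
  push Not at hcon
  have hlt : ∀ s, T.col s = T.col (g t) → T.row s < T.row t := by
    intro s hs
    by_contra hx
    obtain ⟨s', h1, h2⟩ := T.down s (T.row t) (by omega)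
    exact hcon s' h1 (by rw [h2, hs])
  obtain ⟨N, hN⟩ := exists_bound T.col
  have e1 := card_fiber_sum (fun s => T.row s < T.row t) (fun s => T.col (g s)) N (fun _ => hN _)
  have e2 := card_fiber_sum (fun s => T.row s < T.row t) T.col N hN
  rw [e1] at e2
  have := (Finset.sum_eq_sum_iff_of_le (s := Finset.range N)
    (fun c _ => T.col_count (T.row t) c (T.card_col_perm g c).le h)).1 e2 (T.col (g t))
      (by simpa using hN (g t))
  have h3 : (Finset.univ.filter (fun s => T.col s = T.col (g t) ∧ T.row s < T.row t)) =
      (Finset.univ.filter (fun s => T.col s = T.col (g t))) := by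
    ext s
    simp only [Finset.mem_filter, Finset.mem_univ, true_and, and_iff_left_iff_imp]
    exact hlt s
  rw [h3, ← T.card_col_perm g] at this
  have h4 := Finset.eq_of_subset_of_card_le
    (s := Finset.univ.filter (fun s => T.col (g s) = T.col (g t) ∧ T.row s < T.row t))
    (t := Finset.univ.filter (fun s => T.col (g s) = T.col (g t)))
    (by intro s; simp; tauto) this.ge
  have h5 : t ∈ Finset.univ.filter (fun s => T.col (g s) = T.col (g t)) := by simp
  rw [← h4] at h5
  simp at h5

/-- factorization `g = q p`. -/
lemma exists_factor {g : Sn n}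
    (h : ∀ i j, T.row i = T.row j → T.col (g i) = T.col (g j) → i = j) :
    ∃ q ∈ stabF T.col, ∃ p ∈ stabF T.row, g = q * p := by
  choose p hp1 hp2 using T.exists_box h
  have hinj : Function.Injective p := by
    intro t t' ht
    apply h
    · rw [← hp1 t, ← hp1 t', ht]
    · rw [← hp2 t, ← hp2 t', ht]
  let P : Sn n := Equiv.ofBijective p (Finite.injective_iff_bijective.1 hinj)
  have hP : ∀ t, P t = p t := fun t => rfl
  refine ⟨g * P⁻¹, ?_, P, ?_, by simp⟩
  · rw [mem_stabF]
    intro s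
    have := hp2 (P⁻¹ s)
    rw [← hP] at this
    simpa using this.symm
  · rw [mem_stabF]
    intro s; rw [hP, hp1]

/-- the Young symmetrizer -/
noncomputable def c : GA (Sn n) := symB T.col * symA T.row

lemma b_gof_a (g : Sn n) : ∃ k : ℂ, symB T.col * gof g * symA T.row = k • T.c := by
  by_cases h : ∀ i j, T.row i = T.row j → T.col (g i) = T.col (g j) → i = j
  · obtain ⟨q, hq, p, hp, rfl⟩ := T.exists_factor h
    refine ⟨sg q, ?_⟩
    rw [gof_mul, ← mul_assoc, symB_mul_gof hq, mul_assoc, gof_mul_symA hp, smul_mul_assoc, c]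
  · push Not at h
    obtain ⟨i, j, h1, h2, h3⟩ := h
    exact ⟨0, by rw [symB_gof_symA_zero h3 h1 h2, zero_smul]⟩

lemma b_mul_a (x : GA (Sn n)) : ∃ k : ℂ, symB T.col * x * symA T.row = k • T.c := by
  induction x using ind_gof with
  | h0 g => exact T.b_gof_a g
  | hz => exact ⟨0, by simp⟩
  | ha x y hx hy =>
    obtain ⟨k, hk⟩ := hx
    obtain ⟨l, hl⟩ := hy
    exact ⟨k + l, by rw [mul_add, add_mul, hk, hl, add_smul]⟩
  | hs r x hx =>
    obtain ⟨k, hk⟩ := hx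
    exact ⟨r * k, by rw [mul_smul_comm, smul_mul_assoc, hk, smul_smul]⟩

lemma tau_c : tau T.c = 1 := by
  rw [c, symB, symA, Finset.sum_mul, map_sum]
  rw [Finset.sum_eq_single 1]
  · rw [Finset.mul_sum, map_sum, Finset.sum_eq_single 1]
    · rw [gof_one]; simp [sg]; rw [← gof_one, tau_gof]; simp
    · intro p hp hp1
      simp [tau_gof, gof_one, hp1]
    · intro h; exact absurd one_mem_stabF h
  · intro q hq hq1
    rw [Finset.mul_sum, map_sum]
    apply Finset.sum_eq_zero
    intro p hp
    rw [smul_mul_assoc, ← gof_mul, map_smul, tau_gof, if_neg, smul_zero]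
    intro hqp
    apply hq1
    have hq2 : q = p⁻¹ := by rwa [mul_eq_one_iff_eq_inv] at hqp
    have hq3 : q ∈ stabF T.row := by rw [hq2]; exact inv_mem_stabF hp
    ext1 t
    exact T.inj _ _ (mem_stabF.1 hq3 t) (mem_stabF.1 hq t)
  · intro h; exact absurd one_mem_stabF h

lemma exists_k : ∃ k : ℂ, k ≠ 0 ∧ T.c * T.c = k • T.c := by
  obtain ⟨k, hk⟩ := T.b_mul_a (symA T.row * symB T.col)
  have hk' : T.c * T.c = k • T.c := by rw [← hk]; simp only [c, mul_assoc]
  refine ⟨k, ?_, hk'⟩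
  rintro rfl
  rw [zero_smul] at hk'
  have htr := trace_lr T.c 1
  have hnil : IsNilpotent (LinearMap.mulRight ℂ (1 : GA (Sn n)) ∘ₗ LinearMap.mulLeft ℂ T.c) := by
    refine ⟨2, ?_⟩
    refine LinearMap.ext fun x => ?_
    simp [pow_two, ← mul_assoc, hk']
  have h0 := (LinearMap.isNilpotent_trace_of_isNilpotent hnil).eq_zero
  rw [htr, ch_apply] at h0
  have : ∀ h : Sn n, tau (gof h * T.c * gof h⁻¹ * 1) = 1 := by
    intro h
    rw [mul_one, tau_comm, ← mul_assoc, gof_inv_mul, one_mul, tau_c]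
  rw [Finset.sum_congr rfl (fun h _ => this h)] at h0
  simp [Fintype.card_perm] at h0
  exact Nat.factorial_ne_zero n h0

/-- the scalar -/
noncomputable def k : ℂ := T.exists_k.choose
lemma k_ne : T.k ≠ 0 := T.exists_k.choose_spec.1
lemma c_mul_c : T.c * T.c = T.k • T.c := T.exists_k.choose_spec.2

/-- the idempotent -/
noncomputable def e : GA (Sn n) := T.k⁻¹ • T.c

lemma e_idem : T.e * T.e = T.e := by
  rw [e, smul_mul_smul_comm, c_mul_c, smul_smul]
  congr 1
  field_simp [T.k_ne]

lemma c_eq : T.c = T.k • T.e := by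
  rw [e, smul_smul, mul_inv_cancel₀ T.k_ne, one_smul]

lemma tau_e : tau T.e ≠ 0 := by
  rw [e, map_smul, tau_c]
  simpa using T.k_ne

lemma e_mul_a (x : GA (Sn n)) : ∃ k : ℂ, T.e * x * symA T.row = k • T.e := by
  obtain ⟨k, hk⟩ := T.b_mul_a (symA T.row * x)
  refine ⟨k, ?_⟩
  rw [e, c, smul_mul_assoc, smul_mul_assoc, ← mul_assoc] at *
  rw [hk, smul_comm]

lemma e_mul_e (x : GA (Sn n)) : ∃ k : ℂ, T.e * x * T.e = k • T.e := by
  obtain ⟨k, hk⟩ := T.e_mul_a (x * symB T.col)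
  refine ⟨T.k⁻¹ * k, ?_⟩
  nth_rewrite 2 [e]
  rw [mul_smul_comm, mul_smul, ← hk, c]
  simp only [mul_assoc]

/-- linear functional from existence -/
lemma exists_theta (u : GA (Sn n)) (h : ∀ x, ∃ k : ℂ, T.e * x * u = k • T.e) :
    ∃ θ : GA (Sn n) →ₗ[ℂ] ℂ, ∀ x, T.e * x * u = θ x • T.e := by
  refine ⟨(tau T.e)⁻¹ • (tau ∘ₗ LinearMap.mulRight ℂ u ∘ₗ LinearMap.mulLeft ℂ T.e), fun x => ?_⟩
  obtain ⟨k, hk⟩ := h x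
  have : (tau T.e)⁻¹ * tau (T.e * x * u) = k := by
    rw [hk, map_smul, smul_eq_mul]
    field_simp [T.tau_e]
  simp only [LinearMap.smul_apply, LinearMap.comp_apply, LinearMap.mulRight_apply,
    LinearMap.mulLeft_apply, smul_eq_mul]
  rw [this, hk]

lemma smul_e_inj {a b : ℂ} (h : a • T.e = b • T.e) : a = b := by
  have := congrArg tau h
  rw [map_smul, map_smul, smul_eq_mul, smul_eq_mul] at this
  exact mul_right_cancel₀ T.tau_e this

lemma ch_e_self : ch T.e T.e = 1 := by
  obtain ⟨θ, hθ⟩ := T.exists_theta T.e T.e_mul_e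
  rw [ch_eval T.e T.e T.e_idem θ hθ]
  apply T.smul_e_inj
  rw [← hθ, e_idem, e_idem, one_smul]

lemma e_a : T.e * symA T.row = ((stabF T.row).card : ℂ) • T.e := by
  rw [e, c, smul_mul_assoc, mul_assoc, symA_mul_self, mul_smul_comm, smul_comm]

lemma ch_a_self : ch (symA T.row) T.e = ((stabF T.row).card : ℂ) := by
  obtain ⟨θ, hθ⟩ := T.exists_theta _ T.e_mul_a
  rw [ch_eval T.e _ T.e_idem θ hθ]
  apply T.smul_e_inj
  rw [← hθ, e_idem, e_a]

/-- vanishing if dominance fails -/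
lemma b_mul_a_zero {f : Fin n → ℕ} {r : ℕ}
    (h : (Finset.univ.filter (fun t => T.row t < r)).card < (Finset.univ.filter (fun t => f t < r)).card)
    (x : GA (Sn n)) : symB T.col * x * symA f = 0 := by
  induction x using ind_gof with
  | h0 g =>
    by_cases h' : ∀ i j, f i = f j → T.col (g i) = T.col (g j) → i = j
    · have := T.dominance h' r
      omega
    · push Not at h'
      obtain ⟨i, j, h1, h2, h3⟩ := h'
      exact symB_gof_symA_zero h3 h1 h2
  | hz => simp
  | ha x y hx hy => rw [mul_add, add_mul, hx, hy, add_zero]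
  | hs r x hx => rw [mul_smul_comm, smul_mul_assoc, hx, smul_zero]

lemma a_mul_b_zero {f : Fin n → ℕ} {r : ℕ}
    (h : (Finset.univ.filter (fun t => T.row t < r)).card < (Finset.univ.filter (fun t => f t < r)).card)
    (x : GA (Sn n)) : symA f * x * symB T.col = 0 := by
  induction x using ind_gof with
  | h0 g =>
    by_cases h' : ∀ i j, f i = f j → T.col (g⁻¹ i) = T.col (g⁻¹ j) → i = j
    · have := T.dominance h' r
      omega
    · push Not at h'
      obtain ⟨i, j, h1, h2, h3⟩ := h'
      exact symA_gof_symB_zero h3 h1 h2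
  | hz => simp
  | ha x y hx hy => rw [mul_add, add_mul, hx, hy, add_zero]
  | hs r x hx => rw [mul_smul_comm, smul_mul_assoc, hx, smul_zero]

lemma e_orth {T T' : Tab n} {r : ℕ}
    (h : (Finset.univ.filter (fun t => T.row t < r)).card ≠ (Finset.univ.filter (fun t => T'.row t < r)).card)
    (x : GA (Sn n)) : T.e * x * T'.e = 0 := by
  rw [e, e, c, c]
  simp only [smul_mul_assoc, mul_smul_comm]
  rcases lt_or_gt_of_ne h with h | h
  · have : symB T.col * symA T.row * x * (symB T'.col * symA T'.row) = 0 := by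
      have := T.b_mul_a_zero h (symA T.row * x * symB T'.col)
      simpa only [mul_assoc] using this
    rw [this]; simp
  · have : symB T.col * symA T.row * x * (symB T'.col * symA T'.row) = 0 := by
      have := T'.a_mul_b_zero h x
      rw [show symB T.col * symA T.row * x * (symB T'.col * symA T'.row) =
        symB T.col * (symA T.row * x * symB T'.col) * symA T'.row by simp only [mul_assoc], this]
      simp
    rw [this]; simp

lemma ch_a_zero {f : Fin n → ℕ} {r : ℕ}
    (h : (Finset.univ.filter (fun t => T.row t < r)).card < (Finset.univ.filter (fun t => f t < r)).card) :
    ch (symA f) T.e = 0 := by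
  rw [ch_apply]
  apply Finset.sum_eq_zero
  intro g _
  have : gof g * T.e * gof g⁻¹ * symA f = (gof g * (T.k⁻¹ • symB T.col)) * (symA T.row * gof g⁻¹ * symA f) := by
    simp only [e, c, mul_assoc, smul_mul_assoc, mul_smul_comm]
  rw [this, tau_comm]
  rw [show (symA T.row * gof g⁻¹ * symA f) * (gof g * (T.k⁻¹ • symB T.col)) =
    T.k⁻¹ • ((symA T.row * gof g⁻¹) * (symA f * gof g * symB T.col)) by
      simp only [mul_assoc, mul_smul_comm], T.a_mul_b_zero h]
  simp

end Tab
end Young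
end KP

open scoped BigOperators
open scoped Classical
open scoped TensorProduct DirectSum
set_option linter.unusedSectionVars false

namespace KP
open Partition'

section Part
variable {n : ℕ}

lemma ps_succ (l : Partition') (r : ℕ) : partialSum l (r + 1) = partialSum l r + l.1 r := by
  simp [partialSum, Finset.sum_range_succ]

lemma ps_zero (l : Partition') : partialSum l 0 = 0 := by simp [partialSum]

lemma ps_mono (l : Partition') : Monotone (partialSum l) :=
  monotone_nat_of_le_succ (fun r => by rw [ps_succ]; omega)

lemma size_eq_ps (l : Partition') {N : ℕ} (h : ∀ i, N ≤ i → l.1 i = 0) : size l = partialSum l N := by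
  rw [size, partialSum, Finsupp.sum_of_support_subset (s := Finset.range N)]
  · intro i hi
    simp only [Finsupp.mem_support_iff] at hi
    simp only [Finset.mem_range]
    by_contra hx
    exact hi (h i (by omega))
  · simp

lemma exists_N (l : Partition') : ∃ N, ∀ i, N ≤ i → l.1 i = 0 := by
  refine ⟨l.1.support.sup id + 1, fun i hi => ?_⟩
  by_contra hx
  have := Finset.le_sup (f := id) (Finsupp.mem_support_iff.2 hx)
  simp at this
  omega

lemma ps_le_size (l : Partition') (r : ℕ) : partialSum l r ≤ size l := by
  obtain ⟨N, hN⟩ := exists_N l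
  rw [size_eq_ps l (N := max N r) (fun i hi => hN i (by omega))]
  exact ps_mono l (by omega)

lemma ps_ge_of_pos (l : Partition') {r : ℕ} (h : l.1 r ≠ 0) : r + 1 ≤ partialSum l (r + 1) := by
  have : ∀ m, m ≤ r + 1 → m ≤ partialSum l m := by
    intro m
    induction m with
    | zero => intro; omega
    | succ m ih =>
      intro hm
      have h1 := ih (by omega)
      have h2 : l.1 r ≤ l.1 m := l.2 (by omega)
      rw [ps_succ]
      omega
  exact this _ le_rfl

lemma zero_of_size_le (l : Partition') {i : ℕ} (h : size l ≤ i) : l.1 i = 0 := by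
  by_contra hx
  have := ps_ge_of_pos l hx
  have := ps_le_size l (i + 1)
  omega

lemma ps_eq_size (l : Partition') {N : ℕ} (h : l.1 N = 0) : partialSum l N = size l := by
  rw [size_eq_ps l]
  intro i hi
  have := l.2 hi
  omega

lemma rowOf_spec (l : Partition') {t : ℕ} (ht : t < size l) :
    partialSum l (rowOf l t) ≤ t ∧ t < partialSum l (rowOf l t + 1) := by
  constructor
  · exact Nat.findGreatest_spec (P := fun r => partialSum l r ≤ t) (m := 0) (by omega)
      (by simp [ps_zero])
  · by_contra hx
    push Not at hx
    by_cases h : rowOf l t + 1 ≤ t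
    · have := Nat.le_findGreatest (P := fun r => partialSum l r ≤ t) h hx
      unfold rowOf at this
      omega
    · have h1 : rowOf l t ≤ t := Nat.findGreatest_le t
      have h2 : rowOf l t = t := by omega
      rw [h2] at hx
      by_cases h3 : l.1 t = 0
      · have := ps_eq_size l (N := t) h3
        have := ps_mono l (show t ≤ t + 1 by omega)
        omega
      · have := ps_ge_of_pos l h3
        omega

lemma rowOf_eq (l : Partition') {t r : ℕ} (h1 : partialSum l r ≤ t) (h2 : t < partialSum l (r + 1)) :
    rowOf l t = r := by
  have ht : t < size l := lt_of_lt_of_le h2 (ps_le_size _ _)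
  obtain ⟨h3, h4⟩ := rowOf_spec l ht
  rcases lt_trichotomy (rowOf l t) r with h | h | h
  · have := ps_mono l (show rowOf l t + 1 ≤ r by omega)
    omega
  · exact h
  · have := ps_mono l (show r + 1 ≤ rowOf l t by omega)
    omega

lemma rowOf_lt_iff (l : Partition') {t r : ℕ} (ht : t < size l) :
    rowOf l t < r ↔ t < partialSum l r := by
  obtain ⟨h3, h4⟩ := rowOf_spec l ht
  constructor
  · intro h
    have := ps_mono l (show rowOf l t + 1 ≤ r by omega)
    omega
  · intro h
    by_contra hx
    have := ps_mono l (show r ≤ rowOf l t by omega)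
    omega

/-- the canonical tableau -/
noncomputable def tabOf (l : Partition') (h : size l = n) : Tab n where
  row t := rowOf l t
  col t := colOf l t
  inj s t h1 h2 := by
    have hs := rowOf_spec l (t := s) (by omega)
    have ht := rowOf_spec l (t := t) (by omega)
    unfold colOf at h2
    rw [h1] at h2 hs
    ext
    omega
  down s r hr := by
    obtain ⟨h1, h2⟩ := rowOf_spec l (t := s) (by omega)
    have h3 : colOf l s < l.1 r := by
      have : l.1 (rowOf l s) ≤ l.1 r := l.2 hr
      rw [ps_succ] at h2
      unfold colOf
      omega
    have h4 : partialSum l r + colOf l s < partialSum l (r + 1) := by rw [ps_succ]; omega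
    have h5 := ps_le_size l (r + 1)
    have h6 : rowOf l (partialSum l r + colOf l s) = r := rowOf_eq l (by omega) h4
    refine ⟨⟨partialSum l r + colOf l s, by omega⟩, h6, ?_⟩
    change partialSum l r + colOf l s - partialSum l (rowOf l (partialSum l r + colOf l s)) = _
    rw [h6]
    omega

lemma tabOf_row_card (l : Partition') (h : size l = n) (r : ℕ) :
    (Finset.univ.filter (fun t => (tabOf l h).row t < r)).card = partialSum l r := by
  have h1 : ∀ t : Fin n, (tabOf l h).row t < r ↔ (t : ℕ) < partialSum l r := fun t =>
    rowOf_lt_iff l (by omega)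
  simp only [h1]
  have h2 := ps_le_size l r
  rw [Fin.card_filter_val_lt]
  omega

lemma ext_ps {l m : Partition'} (h : ∀ r, partialSum l r = partialSum m r) : l = m := by
  apply Subtype.ext
  ext i
  have h1 := h i
  have h2 := h (i + 1)
  rw [ps_succ, ps_succ] at h2
  omega

/-- partitions of `n` -/
abbrev PP (n : ℕ) := {l : Partition' // size l = n}

instance : Finite (PP n) := by
  have : ∀ (l : PP n) (i : ℕ), l.1.1 i < n + 1 := by
    intro l i
    have h1 := ps_le_size l.1 (i + 1)
    have h2 := l.2
    rw [ps_succ] at h1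
    omega
  apply Finite.of_injective (fun (l : PP n) (i : Fin n) => (⟨l.1.1 i, this l i⟩ : Fin (n + 1)))
  intro l m h
  apply Subtype.ext
  apply Subtype.ext
  ext i
  by_cases hi : i < n
  · have := congrFun h ⟨i, hi⟩
    simpa using this
  · rw [zero_of_size_le l.1 (by rw [l.2]; omega), zero_of_size_le m.1 (by rw [m.2]; omega)]

noncomputable instance : Fintype (PP n) := Fintype.ofFinite _

/-- tableau of a partition of n -/
noncomputable abbrev PP.tab (l : PP n) : Tab n := tabOf l.1 l.2

/-- conjugate partition from a multiset -/
noncomputable def conjP (s : Multiset ℕ) : Partition' :=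
  ⟨Finsupp.onFinset (Finset.range s.sum) (fun i => s.countP (fun p => i < p)) (by
    intro i hi
    simp only [ne_eq, Multiset.countP_eq_zero, not_forall] at hi
    obtain ⟨p, hp, hip⟩ := hi
    have := Multiset.single_le_sum (by simp) p hp
    simp only [Finset.mem_range]
    omega), by
    intro i j hij
    simp only [Finsupp.onFinset_apply]
    rw [Multiset.countP_eq_card_filter, Multiset.countP_eq_card_filter]
    apply Multiset.card_le_card
    apply Multiset.monotone_filter_right
    intro p hp
    omega⟩

lemma conjP_apply (s : Multiset ℕ) (i : ℕ) : (conjP s).1 i = s.countP (fun p => i < p) := rfl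

lemma sum_countP (s : Multiset ℕ) (N : ℕ) (hN : ∀ p ∈ s, p ≤ N) :
    ∑ i ∈ Finset.range N, s.countP (fun p => i < p) = s.sum := by
  induction s using Multiset.induction with
  | empty => simp
  | cons a s ih =>
    simp only [Multiset.countP_cons, Finset.sum_add_distrib, Multiset.sum_cons]
    rw [ih (fun p hp => hN p (Multiset.mem_cons_of_mem hp))]
    have ha := hN a (Multiset.mem_cons_self _ _)
    have : ∑ i ∈ Finset.range N, (if i < a then 1 else 0) = a := by
      rw [← Finset.card_filter]
      have : (Finset.range N).filter (fun i => i < a) = Finset.range a := by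
        ext i; simp; omega
      rw [this]; simp
    omega

lemma size_conjP (s : Multiset ℕ) : size (conjP s) = s.sum := by
  rw [size_eq_ps (conjP s) (N := s.sum), partialSum]
  · simp only [conjP_apply]
    apply sum_countP
    intro p hp
    exact Multiset.single_le_sum (by simp) p hp
  · intro i hi
    rw [conjP_apply, Multiset.countP_eq_zero]
    intro p hp
    have := Multiset.single_le_sum (by simp) p hp
    omega

lemma conjP_inj {s t : Multiset ℕ} (hs : ∀ p ∈ s, 0 < p) (ht : ∀ p ∈ t, 0 < p)
    (h : conjP s = conjP t) : s = t := by
  have h1 : ∀ i, s.countP (fun p => i < p) = t.countP (fun p => i < p) := by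
    intro i; rw [← conjP_apply, h, conjP_apply]
  have h2 : ∀ (u : Multiset ℕ) (i : ℕ), u.countP (fun p => i < p) = u.count (i + 1) + u.countP (fun p => i + 1 < p) := by
    intro u i
    induction u using Multiset.induction with
    | empty => simp
    | cons a u ih =>
      simp only [Multiset.countP_cons, Multiset.count_cons, ih]
      split_ifs <;> omega
  ext i
  cases i with
  | zero =>
    rw [Multiset.count_eq_zero_of_notMem (fun h => absurd (hs _ h) (by omega)),
      Multiset.count_eq_zero_of_notMem (fun h => absurd (ht _ h) (by omega))]
  | succ i =>
    have a := h2 s i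
    have b := h2 t i
    rw [h1 i, h1 (i + 1)] at a
    omega

lemma card_conj_le : Nat.card (ConjClasses (Sn n)) ≤ Fintype.card (PP n) := by
  rw [← Nat.card_eq_fintype_card]
  let F : Sn n → PP n := fun σ => ⟨conjP σ.partition.parts, by
    rw [size_conjP, σ.partition.parts_sum]; simp⟩
  have hF : ∀ σ τ, F σ = F τ ↔ IsConj σ τ := by
    intro σ τ
    rw [Equiv.Perm.partition_eq_of_isConj]
    constructor
    · intro h
      apply Nat.Partition.ext
      exact conjP_inj (fun p hp => σ.partition.parts_pos hp) (fun p hp => τ.partition.parts_pos hp)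
        (congrArg Subtype.val h)
    · intro h
      apply Subtype.ext
      change conjP _ = conjP _
      rw [h]
  apply Nat.card_le_card_of_injective
    (Quotient.lift F (fun a b h => (hF a b).2 h) : ConjClasses (Sn n) → PP n)
  intro a b
  induction a using Quotient.inductionOn
  induction b using Quotient.inductionOn
  intro h
  exact Quotient.sound ((hF _ _).1 h)

lemma pp_ne {l m : PP n} (h : l ≠ m) : ∃ r, partialSum l.1 r ≠ partialSum m.1 r := by
  by_contra hx
  push Not at hx
  exact h (Subtype.ext (ext_ps hx))

lemma e_orth {l m : PP n} (h : l ≠ m) (x : GA (Sn n)) : l.tab.e * x * m.tab.e = 0 := by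
  obtain ⟨r, hr⟩ := pp_ne h
  apply Tab.e_orth (r := r)
  rw [tabOf_row_card, tabOf_row_card]
  exact hr

end Part
end KP

open scoped BigOperators
open scoped Classical
open scoped TensorProduct DirectSum
set_option linter.unusedSectionVars false

namespace KP
open Partition'

section Complete
variable {n : ℕ}

lemma ch_e (l m : PP n) : ch l.tab.e m.tab.e = if l = m then 1 else 0 := by
  split_ifs with h
  · subst h; exact Tab.ch_e_self _
  · rw [ch_apply]
    apply Finset.sum_eq_zero
    intro g _
    rw [mul_assoc, mul_assoc, tau_comm, ← mul_assoc]
    rw [e_orth (Ne.symm h)]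
    simp

/-- class functional -/
def IsCls (f : GA (Sn n) →ₗ[ℂ] ℂ) : Prop := ∀ g x, f (gof g * x * gof g⁻¹) = f x

lemma isCls_ch (u : GA (Sn n)) : IsCls (ch u) := fun g x => ch_conj u x g

lemma IsCls.conj {f : GA (Sn n) →ₗ[ℂ] ℂ} (hf : IsCls f) {a b : Sn n} (h : IsConj a b) :
    f (gof a) = f (gof b) := by
  obtain ⟨c, hc⟩ := isConj_iff.1 h
  rw [← hc, gof_mul, gof_mul, hf]

/-- representative of the class -/
noncomputable def crep (C : ConjClasses (Sn n)) : Sn n := Quotient.out C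

lemma crep_conj (g : Sn n) : IsConj (crep (ConjClasses.mk g)) g := by
  rw [← ConjClasses.mk_eq_mk_iff_isConj]
  exact Quotient.out_eq _

lemma IsCls.ext {f f' : GA (Sn n) →ₗ[ℂ] ℂ} (hf : IsCls f) (hf' : IsCls f')
    (h : ∀ C, f (gof (crep C)) = f' (gof (crep C))) : f = f' := by
  apply ext_gof
  intro a
  rw [← hf.conj (crep_conj a), ← hf'.conj (crep_conj a), h]

/-- linear combination of characters -/
noncomputable def lincomb (c : PP n → ℂ) : GA (Sn n) →ₗ[ℂ] ℂ := ∑ r, c r • ch r.tab.e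

lemma isCls_lincomb (c : PP n → ℂ) : IsCls (lincomb c) := by
  intro g x
  simp only [lincomb, LinearMap.sum_apply, LinearMap.smul_apply, isCls_ch _ g x]

lemma lincomb_e (c : PP n → ℂ) (m : PP n) : lincomb c m.tab.e = c m := by
  simp [lincomb, LinearMap.sum_apply, ch_e]

lemma IsCls.eq_lincomb {f : GA (Sn n) →ₗ[ℂ] ℂ} (hf : IsCls f) :
    f = lincomb (fun r => f r.tab.e) := by
  let Ψ : (PP n → ℂ) →ₗ[ℂ] (ConjClasses (Sn n) → ℂ) :=
    { toFun := fun c C => lincomb c (gof (crep C))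
      map_add' := fun c d => by
        funext C; simp [lincomb, add_mul, Finset.sum_add_distrib]
      map_smul' := fun a c => by
        funext C; simp [lincomb, Finset.mul_sum, mul_assoc] }
  have hinj : Function.Injective Ψ := by
    rw [injective_iff_map_eq_zero]
    intro c hc
    have h0 : lincomb c = 0 := (isCls_lincomb c).ext (fun g x => by simp) (fun C => by
      have := congrFun hc C
      exact this)
    funext m
    rw [← lincomb_e c m, h0]; simp
  have : Fintype (ConjClasses (Sn n)) := Fintype.ofFinite _
  have hfin : Module.finrank ℂ (PP n → ℂ) = Module.finrank ℂ (ConjClasses (Sn n) → ℂ) := by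
    apply le_antisymm (LinearMap.finrank_le_finrank_of_injective hinj)
    rw [Module.finrank_fintype_fun_eq_card, Module.finrank_fintype_fun_eq_card,
      ← Nat.card_eq_fintype_card]
    exact card_conj_le
  obtain ⟨c, hc⟩ := (LinearMap.injective_iff_surjective_of_finrank_eq_finrank hfin).1 hinj
    (fun C => f (gof (crep C)))
  have h1 : f = lincomb c := hf.ext (isCls_lincomb c) (fun C => (congrFun hc C).symm)
  have h2 : c = fun r => f r.tab.e := by
    funext r
    rw [h1, lincomb_e]
  rw [← h2, ← h1]

lemma tau_nondeg {x : GA (Sn n)} (h : ∀ g, tau (gof g * x) = 0) : x = 0 := by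
  rw [expand x]
  apply Finset.sum_eq_zero
  intro g _
  rw [tau_comm, h]; simp

lemma one_eq : (1 : GA (Sn n)) =
    ∑ r : PP n, ∑ h : Sn n, (tau r.tab.e • gof h⁻¹) * r.tab.e * gof h := by
  have hc : IsCls (tau : GA (Sn n) →ₗ[ℂ] ℂ) := fun g x => by
    rw [mul_assoc, tau_comm, mul_assoc, gof_inv_mul, mul_one]
  have h1 := hc.eq_lincomb
  rw [← sub_eq_zero]
  apply tau_nondeg
  intro g
  rw [mul_sub, map_sub, sub_eq_zero, mul_one]
  conv_lhs => rw [h1]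
  rw [lincomb, LinearMap.sum_apply, Finset.mul_sum, map_sum]
  apply Finset.sum_congr rfl
  intro r _
  rw [LinearMap.smul_apply, ch_apply, Finset.mul_sum, map_sum, Finset.smul_sum]
  apply Finset.sum_congr rfl
  intro h _
  rw [smul_mul_assoc, smul_mul_assoc, mul_smul_comm, map_smul]
  congr 1
  rw [mul_assoc, mul_assoc, tau_comm]
  simp only [mul_assoc]

end Complete
end KP

open scoped BigOperators
open scoped Classical
open scoped TensorProduct DirectSum
set_option linter.unusedSectionVars false

namespace KP
open Partition'

section Cnt
variable {n : ℕ} {κ : Type} [Fintype κ] [DecidableEq κ]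

/-- content of a colouring -/
def cnt (f : Fin n → κ) (k : κ) : ℕ := (Finset.univ.filter (fun t => f t = k)).card

lemma cnt_comp (f : Fin n → κ) (h : Sn n) : cnt (f ∘ h) = cnt f := by
  funext k
  apply Finset.card_bij (fun t _ => h t)
  · intro t; simp
  · intro t _ t' _; simp
  · intro t ht; exact ⟨h⁻¹ t, by simpa using ht, by simp⟩

lemma exists_perm {f f' : Fin n → κ} (h : cnt f = cnt f') : ∃ h : Sn n, f ∘ h = f' := by
  have hc : ∀ k, Nonempty ({t // f' t = k} ≃ {t // f t = k}) := by
    intro k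
    apply Fintype.card_eq.1
    rw [Fintype.card_subtype, Fintype.card_subtype]
    exact (congrFun h k).symm
  let hh : Sn n := (Equiv.sigmaFiberEquiv f').symm.trans
    ((Equiv.sigmaCongrRight (fun k => (hc k).some)).trans (Equiv.sigmaFiberEquiv f))
  refine ⟨hh, ?_⟩
  funext t
  exact ((hc (f' t)).some ⟨t, rfl⟩).2

lemma card_trans {f0 f : Fin n → κ} (h : cnt f0 = cnt f) :
    (Finset.univ.filter (fun h : Sn n => f0 ∘ h = f)).card = (stabF f0).card := by
  obtain ⟨p, rfl⟩ := exists_perm h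
  apply Finset.card_bij (fun σ _ => σ * p⁻¹)
  · intro σ hσ
    simp only [Finset.mem_filter, Finset.mem_univ, true_and] at hσ
    rw [mem_stabF]
    intro t
    have := congrFun hσ (p⁻¹ t)
    simpa using this
  · intro a _ b _ hab
    exact mul_right_cancel hab
  · intro σ hσ
    rw [mem_stabF] at hσ
    refine ⟨σ * p, ?_, by simp⟩
    simp only [Finset.mem_filter, Finset.mem_univ, true_and]
    funext t
    simpa using hσ (p t)

lemma card_stab_eq (f : Fin n → κ) :
    (Finset.univ.filter (fun h : Sn n => f ∘ h = f)).card = (stabF f).card :=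
  card_trans rfl

lemma stab_card_congr {f0 f : Fin n → κ} (h : cnt f0 = cnt f) :
    (stabF f0).card = (stabF f).card := by
  obtain ⟨p, rfl⟩ := exists_perm h
  rw [← card_trans (cnt_comp f0 p).symm, ← card_stab_eq]
  apply Finset.card_bij (fun σ _ => p⁻¹ * σ)
  · intro σ hσ
    simp only [Finset.mem_filter, Finset.mem_univ, true_and] at hσ ⊢
    funext t
    have h1 := congrFun hσ (p⁻¹ (σ t))
    have h2 := congrFun hσ t
    simp at h1 h2 ⊢
    exact h2
  · intro a _ b _ hab
    exact mul_left_cancel hab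
  · intro σ hσ
    refine ⟨p * σ, ?_, by simp⟩
    simp only [Finset.mem_filter, Finset.mem_univ, true_and] at hσ ⊢
    funext t
    have := congrFun hσ t
    simpa using this

lemma exists_cnt (M : κ → ℕ) (hM : ∑ k, M k = n) : ∃ f : Fin n → κ, cnt f = M := by
  have hc : Fintype.card (Fin n) = Fintype.card (Σ k, Fin (M k)) := by
    simp [hM]
  let u := Fintype.equivOfCardEq hc
  refine ⟨fun t => (u t).1, ?_⟩
  funext k
  have : (Finset.univ.filter (fun t => (u t).1 = k)).card = (Finset.univ : Finset (Fin (M k))).card := by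
    symm
    apply Finset.card_bij (fun i _ => u.symm ⟨k, i⟩)
    · intro i _; simp
    · intro i _ j _ hij
      simpa using hij
    · intro t ht
      simp only [Finset.mem_filter, Finset.mem_univ, true_and] at ht
      subst ht
      exact ⟨(u t).2, by simp, by simp⟩
  simpa [cnt] using this

lemma sum_cnt (f : Fin n → κ) : ∑ k, cnt f k = n := by
  have := Finset.card_eq_sum_card_fiberwise (s := Finset.univ) (t := Finset.univ) (f := f) (by simp)
  simp only [Finset.card_univ, Fintype.card_fin] at this
  exact this.symm

lemma sum_fix (M : κ → ℕ) (hM : ∑ k, M k = n) :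
    ∑ g : Sn n, (Finset.univ.filter (fun F : Fin n → κ => F ∘ g = F ∧ cnt F = M)).card
      = n.factorial := by
  obtain ⟨f0, hf0⟩ := exists_cnt M hM
  have h1 : ∀ g : Sn n, (Finset.univ.filter (fun F : Fin n → κ => F ∘ g = F ∧ cnt F = M)).card =
      ∑ F ∈ Finset.univ.filter (fun F : Fin n → κ => cnt F = M), if F ∘ g = F then 1 else 0 := by
    intro g
    rw [Finset.sum_ite, Finset.sum_const_zero, add_zero, Finset.sum_const, smul_eq_mul, mul_one,
      Finset.filter_filter]
    congr 1
    ext F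
    simp [and_comm]
  simp only [h1]
  rw [Finset.sum_comm]
  have h2 : ∀ F ∈ Finset.univ.filter (fun F : Fin n → κ => cnt F = M),
      ∑ g : Sn n, (if F ∘ g = F then 1 else 0) =
        (Finset.univ.filter (fun h : Sn n => f0 ∘ h = F)).card := by
    intro F hF
    simp only [Finset.mem_filter, Finset.mem_univ, true_and] at hF
    rw [← Finset.card_filter, card_stab_eq, card_trans (hf0.trans hF.symm)]
    exact (stab_card_congr (hf0.trans hF.symm)).symm
  rw [Finset.sum_congr rfl h2, ← Finset.card_eq_sum_card_fiberwise]
  · simp [Fintype.card_perm]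
  · intro h _
    simp [cnt_comp, hf0]

end Cnt

section Psi
variable {n : ℕ}

/-- integer content -/
def HasC (f : Fin n → Fin n) (a : Fin n → ℤ) : Prop := ∀ i, (cnt f i : ℤ) = a i

lemma youngCount_eq (a : Fin n → ℤ) (g : Sn n) :
    youngCount n a g = ((Finset.univ.filter (fun f : Fin n → Fin n => f ∘ g = f ∧ HasC f a)).card : ℤ) := by
  unfold youngCount
  split_ifs with h
  · rw [Nat.card_eq_fintype_card, Fintype.card_subtype]
    congr 2
    ext f
    simp only [Finset.mem_filter, Finset.mem_univ, true_and, Nat.card_eq_fintype_card,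
      Fintype.card_subtype]
    apply and_congr Iff.rfl
    change _ ↔ ∀ i, (cnt f i : ℤ) = a i
    apply forall_congr'
    intro i
    have := h i
    unfold cnt
    constructor
    · intro h1
      rw [show ((Finset.univ.filter (fun t => f t = i)).card) = (a i).toNat from h1]
      omega
    · intro h1
      rw [← h1]; simp
  · rw [Finset.card_eq_zero.2]; · simp
    rw [Finset.filter_eq_empty_iff]
    rintro f - ⟨-, hf⟩
    apply h
    intro i
    rw [← hf i]; omega

/-- the permutation character as functional -/
noncomputable def psi (a : Fin n → ℤ) : GA (Sn n) →ₗ[ℂ] ℂ :=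
  gbasis.constr ℂ (fun g => ((youngCount n a g : ℤ) : ℂ))

lemma psi_gof (a : Fin n → ℤ) (g : Sn n) : psi a (gof g) = ((youngCount n a g : ℤ) : ℂ) := by
  rw [← gbasis_apply, psi, Module.Basis.constr_basis]

lemma psi_zero {a : Fin n → ℤ} (h : ∀ f : Fin n → Fin n, ¬ HasC f a) : psi a = 0 := by
  apply ext_gof
  intro g
  rw [psi_gof, youngCount_eq]
  simp [h]

/-- natural-valued version -/
abbrev nv (f : Fin n → Fin n) : Fin n → ℕ := fun t => (f t : ℕ)

lemma stabF_nv (f : Fin n → Fin n) : stabF (nv f) = stabF f := by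
  ext σ
  simp [mem_stabF, Fin.val_inj]

lemma psi_eq {a : Fin n → ℤ} {f : Fin n → Fin n} (h : HasC f a) :
    ((stabF f).card : ℂ) • psi a = ch (symA (nv f)) := by
  apply ext_gof
  intro g
  rw [LinearMap.smul_apply, psi_gof, youngCount_eq, ch_apply]
  have h1 : ∀ p : Sn n, tau (gof p * gof g * gof p⁻¹ * symA (nv f)) =
      if (f ∘ p) ∘ g = f ∘ p then 1 else 0 := by
    intro p
    rw [symA, Finset.mul_sum, map_sum, stabF_nv]
    simp only [← gof_mul, tau_gof]
    have : ∀ σ : Sn n, (p * g * p⁻¹ * σ = 1) ↔ σ = (p * g * p⁻¹)⁻¹ := by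
      intro σ; rw [mul_eq_one_iff_inv_eq, eq_comm]
    simp only [this]
    rw [Finset.sum_ite_eq']
    congr 1
    rw [eq_iff_iff]
    constructor
    · intro h1
      have h2 := inv_mem_stabF h1
      rw [inv_inv, mem_stabF] at h2
      funext t
      have := h2 (p t)
      simpa using this
    · intro h1
      apply inv_mem_stabF
      rw [mem_stabF]
      intro t
      have := congrFun h1 (p⁻¹ t)
      simpa using this
  simp only [h1]
  rw [← Finset.sum_fiberwise_of_maps_to (s := Finset.univ)
    (t := Finset.univ.filter (fun F : Fin n → Fin n => HasC F a)) (g := fun p : Sn n => f ∘ p)]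
  · have h2 : ∀ F ∈ Finset.univ.filter (fun F : Fin n → Fin n => HasC F a),
        (∑ p ∈ Finset.univ.filter (fun p : Sn n => f ∘ p = F), if (f ∘ p) ∘ g = f ∘ p then (1:ℂ) else 0) =
          ((stabF f).card : ℂ) * if F ∘ g = F then 1 else 0 := by
      intro F hF
      simp only [Finset.mem_filter, Finset.mem_univ, true_and] at hF
      have hc : cnt f = cnt F := by
        funext i
        have := h i
        have := hF i
        omega
      rw [← card_trans hc, ← nsmul_eq_mul, ← Finset.sum_const]
      apply Finset.sum_congr rfl
      intro p hp
      simp only [Finset.mem_filter, Finset.mem_univ, true_and] at hp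
      rw [hp]
    rw [Finset.sum_congr rfl h2, ← Finset.mul_sum]
    rw [Finset.sum_ite, Finset.sum_const_zero, add_zero, Finset.sum_const, nsmul_eq_mul, mul_one,
      Finset.filter_filter, smul_eq_mul]
    congr 2
    norm_cast
    congr 1
    ext F
    simp [and_comm]
  · intro p _
    simp only [Finset.mem_filter, Finset.mem_univ, true_and]
    intro i
    rw [cnt_comp, h i]

lemma stab_card_ne {κ : Type} (f : Fin n → κ) : ((stabF f).card : ℂ) ≠ 0 := by
  have : (stabF f).Nonempty := ⟨1, one_mem_stabF⟩
  have := Finset.card_pos.2 this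
  exact_mod_cast this.ne'

lemma psi_eq' {a : Fin n → ℤ} {f : Fin n → Fin n} (h : HasC f a) :
    psi a = ((stabF f).card : ℂ)⁻¹ • ch (symA (nv f)) := by
  rw [← psi_eq h, smul_smul, inv_mul_cancel₀ (stab_card_ne f), one_smul]

lemma isCls_psi (a : Fin n → ℤ) : IsCls (psi a) := by
  by_cases h : ∃ f : Fin n → Fin n, HasC f a
  · obtain ⟨f, hf⟩ := h
    rw [psi_eq' hf]
    intro g x
    simp [ch_conj]
  · push Not at h
    rw [psi_zero h]
    intro g x; simp

/-- prefix sums of a composition -/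
noncomputable def pre (a : Fin n → ℤ) (r : ℕ) : ℤ := ∑ i ∈ Finset.univ.filter (fun i : Fin n => (i : ℕ) < r), a i

lemma card_lt_pre {a : Fin n → ℤ} {f : Fin n → Fin n} (h : HasC f a) (r : ℕ) :
    ((Finset.univ.filter (fun t => nv f t < r)).card : ℤ) = pre a r := by
  rw [pre, Finset.card_eq_sum_card_fiberwise (f := f) (t := Finset.univ.filter (fun i : Fin n => (i : ℕ) < r))]
  · push_cast
    apply Finset.sum_congr rfl
    intro i hi
    simp only [Finset.mem_filter, Finset.mem_univ, true_and] at hi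
    rw [← h i, cnt, Finset.filter_filter]
    congr 2
    ext t
    simp only [Finset.mem_filter, Finset.mem_univ, true_and]
    constructor
    · rintro ⟨-, h⟩; exact h
    · intro h; subst h; exact ⟨hi, rfl⟩
  · intro t ht
    simpa using ht

lemma psi_e_zero {a : Fin n → ℤ} {m : PP n} {r : ℕ} (h : (partialSum m.1 r : ℤ) < pre a r) :
    psi a m.tab.e = 0 := by
  by_cases hx : ∃ f : Fin n → Fin n, HasC f a
  · obtain ⟨f, hf⟩ := hx
    rw [psi_eq' hf, LinearMap.smul_apply, Tab.ch_a_zero (r := r), smul_zero]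
    have := card_lt_pre hf r
    have h2 : (Finset.univ.filter (fun t => m.tab.row t < r)).card = _ := tabOf_row_card m.1 m.2 r
    omega
  · push Not at hx
    rw [psi_zero hx]; simp

/-- a partition as composition -/
def comp (m : PP n) : Fin n → ℤ := fun i => (m.1.1 i : ℤ)

lemma row_lt (m : PP n) (t : Fin n) : m.tab.row t < n := by
  change rowOf m.1 t < n
  rw [rowOf_lt_iff _ (by rw [m.2]; exact t.2), ps_eq_size, m.2]
  · exact t.2
  · apply zero_of_size_le; rw [m.2]

lemma psi_e_self (m : PP n) : psi (comp m) m.tab.e = 1 := by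
  let f : Fin n → Fin n := fun t => ⟨m.tab.row t, row_lt m t⟩
  have hf : HasC f (comp m) := by
    intro i
    have h1 := tabOf_row_card m.1 m.2 i
    have h2 := tabOf_row_card m.1 m.2 (i + 1)
    have h3 : (Finset.univ.filter (fun t => m.tab.row t < i + 1)) =
        (Finset.univ.filter (fun t => m.tab.row t < i)) ∪ (Finset.univ.filter (fun t => f t = i)) := by
      ext t
      simp only [Finset.mem_filter, Finset.mem_univ, true_and, Finset.mem_union, f, Fin.ext_iff]
      omega
    have h4 : Disjoint (Finset.univ.filter (fun t => m.tab.row t < i)) (Finset.univ.filter (fun t => f t = i)) := by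
      rw [Finset.disjoint_filter]
      intro t _ h5
      simp only [f, Fin.ext_iff]
      omega
    have h5 := Finset.card_union_of_disjoint h4
    rw [← h3] at h5
    rw [ps_succ] at h2
    simp only [cnt, comp]
    have : (Finset.univ.filter (fun t => m.tab.row t < i + 1)).card = (Finset.univ.filter (fun t => m.tab.row t < i)).card + m.1.1 i := by
      rw [h1, h2]
    omega
  rw [psi_eq' hf, LinearMap.smul_apply]
  have h1 : nv f = m.tab.row := rfl
  rw [h1, Tab.ch_a_self, ← stabF_nv f, h1, smul_eq_mul, inv_mul_cancel₀ (stab_card_ne _)]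

end Psi
end KP

open scoped BigOperators
open scoped Classical
open scoped TensorProduct DirectSum
set_option linter.unusedSectionVars false

namespace KP
open Partition'

section Pieri
variable {n : ℕ}

/-- vectors of naturals with given sum -/
noncomputable abbrev vec (n b : ℕ) : Finset (Fin n → ℕ) := Finset.piAntidiag Finset.univ b

lemma mem_vec {b : ℕ} {m : Fin n → ℕ} : m ∈ vec n b ↔ ∑ i, m i = b := by
  simp [vec, Finset.mem_piAntidiag]

/-- number of matrices with prescribed margins -/
noncomputable def NN : ℕ → (ℕ → ℕ) → (Fin n → ℤ) → ℤ
  | 0, _, a => if a = 0 then 1 else 0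
  | k + 1, mu, a => ∑ m ∈ vec n (mu 0), NN k (fun i => mu (i + 1)) (fun i => a i - (m i : ℤ))

lemma NN_neg (k : ℕ) : ∀ (mu : ℕ → ℕ) (a : Fin n → ℤ) (i : Fin n), a i < 0 → NN k mu a = 0 := by
  induction k with
  | zero =>
    intro mu a i h
    rw [NN, if_neg]
    rintro rfl
    simp at h
  | succ k ih =>
    intro mu a i h
    rw [NN]
    apply Finset.sum_eq_zero
    intro m _
    apply ih _ _ i
    omega

lemma NN_perm (k : ℕ) : ∀ (mu : ℕ → ℕ) (a : Fin n → ℤ) (τ : Sn n), NN k mu (a ∘ τ) = NN k mu a := by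
  induction k with
  | zero =>
    intro mu a τ
    rw [NN, NN]
    congr 1
    rw [eq_iff_iff]
    constructor
    · intro h
      funext i
      have := congrFun h (τ⁻¹ i)
      simpa using this
    · rintro rfl
      rfl
  | succ k ih =>
    intro mu a τ
    rw [NN, NN]
    refine Finset.sum_bij' (fun m _ => m ∘ (τ⁻¹ : Sn n)) (fun m _ => m ∘ τ) ?_ ?_ ?_ ?_ ?_
    · intro m hm
      rw [mem_vec] at hm ⊢
      rw [← hm]
      exact Equiv.sum_comp (τ⁻¹ : Sn n) m
    · intro m hm
      rw [mem_vec] at hm ⊢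
      rw [← hm]
      exact Equiv.sum_comp τ m
    · intro m _; funext i; simp
    · intro m _; funext i; simp
    · intro m _
      rw [← ih _ (fun i => a i - _) τ]
      congr 1
      funext i
      simp

/-- signed number -/
noncomputable def GG (k : ℕ) (mu : ℕ → ℕ) (c : Fin n → ℤ) : ℤ :=
  ∑ σ : Sn n, (Equiv.Perm.sign σ : ℤ) * NN k mu (fun i => c i + ((σ i : ℕ) : ℤ))

lemma GG_succ (k : ℕ) (mu : ℕ → ℕ) (c : Fin n → ℤ) :
    GG (k + 1) mu c = ∑ m ∈ vec n (mu 0), GG k (fun i => mu (i + 1)) (fun i => c i - (m i : ℤ)) := by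
  simp only [GG, NN, Finset.mul_sum]
  rw [Finset.sum_comm]
  refine Finset.sum_congr rfl fun m _ => Finset.sum_congr rfl fun σ _ => ?_
  congr 2
  funext i
  ring

lemma GG_perm (k : ℕ) (mu : ℕ → ℕ) (c : Fin n → ℤ) (τ : Sn n) :
    GG k mu (c ∘ τ) = (Equiv.Perm.sign τ : ℤ) * GG k mu c := by
  simp only [GG, Finset.mul_sum]
  refine (Fintype.sum_equiv (Equiv.mulRight τ) _ _ (fun σ => ?_)).symm
  simp only [Equiv.coe_mulRight, Equiv.Perm.sign_mul]
  rw [← NN_perm k mu _ τ]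
  push_cast
  have : ((fun i => c i + ((σ i : ℕ) : ℤ)) ∘ τ) = fun i => (c ∘ τ) i + (((σ * τ) i : ℕ) : ℤ) := rfl
  rw [this]
  simp only [Equiv.Perm.coe_mul]
  ring

lemma GG_swap (k : ℕ) (mu : ℕ → ℕ) (c : Fin n → ℤ) {i j : Fin n} (h : i ≠ j) :
    GG k mu (c ∘ Equiv.swap i j) = - GG k mu c := by
  rw [GG_perm, Equiv.Perm.sign_swap h]; simp

lemma GG_low (k : ℕ) (mu : ℕ → ℕ) (c : Fin n → ℤ) (i : Fin n) (h : c i + n ≤ 0) :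
    GG k mu c = 0 := by
  apply Finset.sum_eq_zero
  intro σ _
  rw [NN_neg k mu _ i, mul_zero]
  have := (σ i).2
  omega

/-- bad index -/
def bad (c : ℕ → ℤ) (m : Fin n → ℕ) (i : ℕ) : Prop :=
  ∃ h : i + 1 < n, c i - m ⟨i, by omega⟩ ≤ c (i + 1)

/-- swapping the values -/
noncomputable def sw (c : ℕ → ℤ) (i : ℕ) (m : Fin n → ℕ) : Fin n → ℕ :=
  if h : i + 1 < n then fun t =>
    (c t - (c (Equiv.swap (⟨i, by omega⟩ : Fin n) ⟨i + 1, h⟩ t : Fin n) -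
      m (Equiv.swap (⟨i, by omega⟩ : Fin n) ⟨i + 1, h⟩ t))).toNat
  else m

lemma sw_spec (c : ℕ → ℤ) (hc : ∀ i, c (i + 1) < c i) {i : ℕ} {m : Fin n → ℕ} (h : i + 1 < n)
    (hb : bad c m i) (t : Fin n) : c t - (sw c i m t : ℤ) =
      c (Equiv.swap (⟨i, by omega⟩ : Fin n) ⟨i + 1, h⟩ t : Fin n) -
      m (Equiv.swap (⟨i, by omega⟩ : Fin n) ⟨i + 1, h⟩ t) := by
  obtain ⟨h', hb⟩ := hb
  rw [sw, dif_pos h]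
  have hci := hc i
  suffices 0 ≤ (c t - (c (Equiv.swap (⟨i, by omega⟩ : Fin n) ⟨i + 1, h⟩ t : Fin n) -
      m (Equiv.swap (⟨i, by omega⟩ : Fin n) ⟨i + 1, h⟩ t))) by omega
  by_cases h1 : t = ⟨i, by omega⟩
  · subst h1
    rw [Equiv.swap_apply_left]
    change 0 ≤ c i - (c (i + 1) - _)
    omega
  · by_cases h2 : t = ⟨i + 1, h⟩
    · subst h2
      rw [Equiv.swap_apply_right]
      change 0 ≤ c (i + 1) - (c i - _)
      omega
    · rw [Equiv.swap_apply_of_ne_of_ne h1 h2]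
      omega

lemma bad_sw (c : ℕ → ℤ) (hc : ∀ i, c (i + 1) < c i) {i : ℕ} {m : Fin n → ℕ}
    (hb : bad c m i) : bad c (sw c i m) i := by
  obtain ⟨h, hb'⟩ := id hb
  refine ⟨h, ?_⟩
  have := sw_spec c hc h hb ⟨i, by omega⟩
  rw [Equiv.swap_apply_left] at this
  simp only at this
  rw [this]
  omega

lemma bad_sw_lt (c : ℕ → ℤ) (hc : ∀ i, c (i + 1) < c i) {i j : ℕ} {m : Fin n → ℕ}
    (hb : bad c m i) (hj : j < i) : bad c (sw c i m) j ↔ bad c m j := by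
  obtain ⟨h, hb'⟩ := id hb
  have := sw_spec c hc h hb ⟨j, by omega⟩
  rw [Equiv.swap_apply_of_ne_of_ne (by simp; omega) (by simp; omega)] at this
  simp only [bad]
  simp only at this
  apply exists_congr
  intro h1
  rw [this]

lemma sw_sw (c : ℕ → ℤ) (hc : ∀ i, c (i + 1) < c i) {i : ℕ} {m : Fin n → ℕ}
    (hb : bad c m i) : sw c i (sw c i m) = m := by
  obtain ⟨h, hb'⟩ := id hb
  funext t
  have h1 := sw_spec c hc h (bad_sw c hc hb) t
  rw [sw_spec c hc h hb, Equiv.swap_apply_self] at h1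
  omega

lemma sum_sw (c : ℕ → ℤ) (hc : ∀ i, c (i + 1) < c i) {i : ℕ} {m : Fin n → ℕ}
    (hb : bad c m i) : ∑ t, sw c i m t = ∑ t, m t := by
  obtain ⟨h, hb'⟩ := id hb
  have h1 : ∑ t : Fin n, (c t - (sw c i m t : ℤ)) = ∑ t : Fin n, (c t - (m t : ℤ)) := by
    rw [Finset.sum_congr rfl (fun t _ => sw_spec c hc h hb t)]
    exact Equiv.sum_comp (Equiv.swap (⟨i, by omega⟩ : Fin n) ⟨i + 1, h⟩)
      (fun t : Fin n => c t - (m t : ℤ))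
  rw [Finset.sum_sub_distrib, Finset.sum_sub_distrib] at h1
  have h2 : ∑ t, (sw c i m t : ℤ) = ∑ t, (m t : ℤ) := by linarith
  exact_mod_cast h2

lemma bad_sum (c : ℕ → ℤ) (hc : ∀ i, c (i + 1) < c i) (k : ℕ) (mu : ℕ → ℕ) (b : ℕ) :
    ∑ m ∈ (vec n b).filter (fun m => ∃ i, bad c m i), GG k mu (fun i : Fin n => c i - (m i : ℤ)) = 0 := by
  have hex : ∀ m ∈ (vec n b).filter (fun m => ∃ i, bad c m i), ∃ i, bad c m i := by
    intro m hm
    exact (Finset.mem_filter.1 hm).2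
  have hGG : ∀ m (i : ℕ), bad c m i → GG k mu (fun t : Fin n => c t - (sw c i m t : ℤ)) =
      - GG k mu (fun i : Fin n => c i - (m i : ℤ)) := by
    intro m i hb
    obtain ⟨h, hb'⟩ := id hb
    rw [← GG_swap k mu _ (i := (⟨i, by omega⟩ : Fin n)) (j := ⟨i + 1, h⟩) (by simp)]
    congr 1
    funext t
    exact sw_spec c hc h hb t
  have hmem : ∀ m (i : ℕ), bad c m i → m ∈ vec n b → sw c i m ∈ (vec n b).filter (fun m => ∃ i, bad c m i) := by
    intro m i hb hm
    rw [Finset.mem_filter]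
    refine ⟨?_, i, bad_sw c hc hb⟩
    rw [mem_vec] at hm ⊢
    rw [sum_sw c hc hb, hm]
  refine Finset.sum_involution (fun m hm => sw c (Nat.find (hex m hm)) m) ?_ ?_ ?_ ?_
  · intro m hm
    rw [hGG m _ (Nat.find_spec (hex m hm))]
    ring
  · intro m hm hne heq
    have := hGG m _ (Nat.find_spec (hex m hm))
    rw [heq] at this
    omega
  · intro m hm
    exact hmem m _ (Nat.find_spec (hex m hm)) (Finset.mem_filter.1 hm).1
  · intro m hm
    have hb := Nat.find_spec (hex m hm)
    have h1 : ∀ h : (∃ i, bad c (sw c (Nat.find (hex m hm)) m) i), Nat.find h = Nat.find (hex m hm) := by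
      intro h
      rw [Nat.find_eq_iff]
      refine ⟨bad_sw c hc hb, fun j hj => ?_⟩
      rw [bad_sw_lt c hc hb hj]
      exact Nat.find_min _ hj
    simp only [h1]
    exact sw_sw c hc hb

lemma peel (l : ℕ → ℕ) (hl : Antitone l) (hn : l n = 0) (k : ℕ) (mu : ℕ → ℕ)
    (h : GG (k + 1) mu (fun i : Fin n => (l i : ℤ) - (i : ℤ)) ≠ 0) :
    mu 0 ≤ l 0 ∧ (mu 0 = l 0 → GG k (fun i => mu (i + 1)) (fun i : Fin n => (l (i + 1) : ℤ) - (i : ℤ)) ≠ 0) := by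
  let c : ℕ → ℤ := fun i => (l i : ℤ) - (i : ℤ)
  have hc : ∀ i, c (i + 1) < c i := by
    intro i
    have := hl (show i ≤ i + 1 by omega)
    simp only [c]
    push_cast
    omega
  rw [GG_succ, ← Finset.sum_filter_add_sum_filter_not _ (fun m => ∃ i, bad c m i)] at h
  rw [show (∑ m ∈ (vec n (mu 0)).filter (fun m => ∃ i, bad c m i),
    GG k (fun i => mu (i + 1)) (fun i : Fin n => (l i : ℤ) - (i : ℤ) - (m i : ℤ))) = 0 from bad_sum c hc _ _ _,
    zero_add] at h
  obtain ⟨m, hm, hne⟩ := Finset.exists_ne_zero_of_sum_ne_zero h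
  rw [Finset.mem_filter, mem_vec] at hm
  obtain ⟨hm, hgood⟩ := hm
  push Not at hgood
  have hle : ∀ i : Fin n, m i ≤ l i - l (i + 1) := by
    intro i
    have hmono := hl (show (i : ℕ) ≤ i + 1 by omega)
    by_cases hi : (i : ℕ) + 1 < n
    · have := hgood i
      simp only [bad, not_exists, c] at this
      have := this hi
      push_cast at this
      simp only [Fin.eta] at this
      omega
    · have hin : (i : ℕ) + 1 = n := by have := i.2; omega
      by_contra hx
      apply hne
      apply GG_low _ _ _ i
      rw [hin, hn] at hx
      have : (n : ℤ) = i + 1 := by exact_mod_cast hin.symm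
      rw [this]
      omega
  have htel : ∑ i : Fin n, (l i - l (i + 1)) = l 0 := by
    rw [Fin.sum_univ_eq_sum_range (fun i => l i - l (i + 1))]
    have : ∀ N, ∑ i ∈ Finset.range N, (l i - l (i + 1)) + l N = l 0 := by
      intro N
      induction N with
      | zero => simp
      | succ N ih =>
        rw [Finset.sum_range_succ]
        have := hl (show N ≤ N + 1 by omega)
        omega
    have := this n
    omega
  refine ⟨?_, fun heq => ?_⟩
  · rw [← hm, ← htel]
    exact Finset.sum_le_sum fun i _ => hle i
  · have h1 : ∀ i ∈ Finset.univ, m i = l i - l (i + 1) :=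
      (Finset.sum_eq_sum_iff_of_le (fun i _ => hle i)).1 (by rw [hm, htel, heq])
    convert hne using 2
    funext i
    have := h1 i (Finset.mem_univ _)
    have := hl (show (i : ℕ) ≤ i + 1 by omega)
    omega

lemma lex_vanish (j : ℕ) : ∀ (k : ℕ) (l mu : ℕ → ℕ) (_ : Antitone l) (_ : l n = 0) (_ : j < k)
    (_ : ∀ i < j, mu i = l i) (_ : l j < mu j),
    GG k mu (fun i : Fin n => (l i : ℤ) - (i : ℤ)) = 0 := by
  induction j with
  | zero =>
    intro k l mu hl hn hk _ h
    obtain ⟨k, rfl⟩ : ∃ k', k = k' + 1 := ⟨k - 1, by omega⟩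
    by_contra hx
    have := (peel l hl hn k mu hx).1
    omega
  | succ j ih =>
    intro k l mu hl hn hk he h
    obtain ⟨k, rfl⟩ : ∃ k', k = k' + 1 := ⟨k - 1, by omega⟩
    by_contra hx
    apply (peel l hl hn k mu hx).2 (he 0 (by omega))
    apply ih k (fun i => l (i + 1)) (fun i => mu (i + 1)) (fun a b hab => hl (by omega)) _ (by omega)
      (fun i hi => he (i + 1) (by omega)) h
    have := hl (show n ≤ n + 1 by omega)
    change l (n + 1) = 0
    omega

end Pieri
end KP

open scoped BigOperators
open scoped Classical
open scoped TensorProduct DirectSum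
set_option linter.unusedSectionVars false

namespace KP
open Partition'

section Mat
variable {n : ℕ}

lemma NN_card (k : ℕ) : ∀ (mu : ℕ → ℕ) (a : Fin n → ℤ), NN k mu a =
    ∑ M ∈ Fintype.piFinset (fun j : Fin k => vec n (mu j)),
      if ∀ i, ((∑ j, M j i : ℕ) : ℤ) = a i then 1 else 0 := by
  induction k with
  | zero =>
    intro mu a
    simp only [NN, Fintype.piFinset_of_isEmpty, Finset.univ_unique, Finset.sum_singleton,
      Finset.univ_eq_empty, Finset.sum_empty, Nat.cast_zero]
    congr 1
    rw [eq_iff_iff, funext_iff]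
    apply forall_congr'
    intro i
    rw [eq_comm]; rfl
  | succ k ih =>
    intro mu a
    simp only [NN, ih]
    rw [← Finset.sum_product']
    refine Finset.sum_bij' (fun p _ => Fin.cons p.1 p.2) (fun M _ => (M 0, Fin.tail M)) ?_ ?_ ?_ ?_ ?_
    · rintro ⟨m, M⟩ h
      rw [Finset.mem_product, Fintype.mem_piFinset] at h
      rw [Fintype.mem_piFinset]
      intro j
      refine Fin.cases ?_ ?_ j
      · exact h.1
      · intro j; exact h.2 j
    · intro M h
      rw [Fintype.mem_piFinset] at h
      rw [Finset.mem_product, Fintype.mem_piFinset]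
      exact ⟨h 0, fun j => h j.succ⟩
    · rintro ⟨m, M⟩ _; simp
    · intro M _; simp
    · rintro ⟨m, M⟩ _
      congr 1
      rw [eq_iff_iff]
      apply forall_congr'
      intro i
      rw [Fin.sum_univ_succ]
      simp only [Fin.cons_zero, Fin.cons_succ]
      push_cast
      constructor <;> intro h <;> linarith

lemma cnt_snd (F : Fin n → Fin n × Fin n) (i : Fin n) :
    cnt (fun t => (F t).2) i = ∑ j, cnt F (j, i) := by
  unfold cnt
  rw [Finset.card_eq_sum_card_fiberwise (f := fun t => (F t).1) (t := Finset.univ) (by simp)]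
  refine Finset.sum_congr rfl fun j _ => ?_
  rw [Finset.filter_filter]
  congr 1
  ext t
  simp [Prod.ext_iff, and_comm]

lemma cnt_fst (F : Fin n → Fin n × Fin n) (j : Fin n) :
    cnt (fun t => (F t).1) j = ∑ i, cnt F (j, i) := by
  unfold cnt
  rw [Finset.card_eq_sum_card_fiberwise (f := fun t => (F t).2) (t := Finset.univ) (by simp)]
  refine Finset.sum_congr rfl fun i _ => ?_
  rw [Finset.filter_filter]
  congr 1
  ext t
  simp [Prod.ext_iff]

lemma sum_pp (m : PP n) : ∑ i : Fin n, m.1.1 i = n := by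
  rw [Fin.sum_univ_eq_sum_range (fun i => m.1.1 i)]
  change partialSum m.1 n = n
  rw [ps_eq_size, m.2]
  apply zero_of_size_le; rw [m.2]

lemma inner_young (a : Fin n → ℤ) (m : PP n) :
    ∑ g : Sn n, youngCount n (comp m) g * youngCount n a g = (n.factorial : ℤ) * NN n m.1.1 a := by
  have h1 : ∀ g : Sn n, youngCount n (comp m) g * youngCount n a g =
      ((Finset.univ.filter (fun F : Fin n → Fin n × Fin n => F ∘ g = F ∧
        HasC (fun t => (F t).1) (comp m) ∧ HasC (fun t => (F t).2) a)).card : ℤ) := by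
    intro g
    rw [youngCount_eq, youngCount_eq]
    norm_cast
    rw [← Finset.card_product]
    refine Finset.card_bij' (fun p _ t => (p.1 t, p.2 t)) (fun F _ => (fun t => (F t).1, fun t => (F t).2)) ?_ ?_ ?_ ?_
    · rintro ⟨f, f'⟩ h
      simp only [Finset.mem_product, Finset.mem_filter, Finset.mem_univ, true_and] at h ⊢
      refine ⟨?_, h.1.2, h.2.2⟩
      funext t
      have h1 := congrFun h.1.1 t
      have h2 := congrFun h.2.1 t
      simp only [Function.comp_apply] at h1 h2 ⊢
      rw [h1, h2]
    · intro F h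
      simp only [Finset.mem_product, Finset.mem_filter, Finset.mem_univ, true_and] at h ⊢
      refine ⟨⟨?_, h.2.1⟩, ?_, h.2.2⟩
      · funext t
        exact congrArg Prod.fst (congrFun h.1 t)
      · funext t
        exact congrArg Prod.snd (congrFun h.1 t)
    · rintro ⟨f, f'⟩ _; rfl
    · intro F _; rfl
  simp only [h1]
  rw [NN_card, Finset.sum_ite, Finset.sum_const_zero, add_zero, Finset.sum_const, nsmul_eq_mul, mul_one]
  norm_cast
  set S := (Fintype.piFinset (fun j : Fin n => vec n (m.1.1 j))).filter
    (fun M => ∀ i, ((∑ j, M j i : ℕ) : ℤ) = a i) with hS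
  have hmem : ∀ F : Fin n → Fin n × Fin n, (HasC (fun t => (F t).1) (comp m) ∧ HasC (fun t => (F t).2) a) ↔
      (fun j i => cnt F (j, i)) ∈ S := by
    intro F
    rw [hS, Finset.mem_filter, Fintype.mem_piFinset]
    simp only [mem_vec, HasC, comp, cnt_fst, cnt_snd]
    apply and_congr _ Iff.rfl
    apply forall_congr'
    intro j
    norm_cast
  have h2 : ∀ g : Sn n, (Finset.univ.filter (fun F : Fin n → Fin n × Fin n => F ∘ g = F ∧
        HasC (fun t => (F t).1) (comp m) ∧ HasC (fun t => (F t).2) a)).card =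
      ∑ M ∈ S, (Finset.univ.filter (fun F : Fin n → Fin n × Fin n => F ∘ g = F ∧
        cnt F = fun p => M p.1 p.2)).card := by
    intro g
    rw [Finset.card_eq_sum_card_fiberwise (f := fun (F : Fin n → Fin n × Fin n) j i => cnt F (j, i)) (t := S)]
    · refine Finset.sum_congr rfl fun M hM => ?_
      rw [Finset.filter_filter]
      congr 1
      ext F
      simp only [Finset.mem_filter, Finset.mem_univ, true_and, hmem]
      constructor
      · rintro ⟨⟨h3, h4⟩, h5⟩
        refine ⟨h3, ?_⟩
        rw [← h5]
      · rintro ⟨h3, h4⟩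
        have h5 : (fun j i => cnt F (j, i)) = M := by rw [h4]
        exact ⟨⟨h3, by rw [h5]; exact hM⟩, h5⟩
    · intro F hF
      simp only [Finset.coe_filter, Finset.mem_univ, true_and, Set.mem_ofPred_eq] at hF
      exact (hmem F).1 hF.2
  simp only [h2]
  rw [Finset.sum_comm]
  have h3 : ∀ M ∈ S, ∑ g : Sn n, (Finset.univ.filter (fun F : Fin n → Fin n × Fin n => F ∘ g = F ∧
        cnt F = fun p => M p.1 p.2)).card = n.factorial := by
    intro M hM
    apply sum_fix
    rw [hS, Finset.mem_filter, Fintype.mem_piFinset] at hM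
    rw [Fintype.sum_prod_type]
    rw [Finset.sum_congr rfl (fun j _ => mem_vec.1 (hM.1 j))]
    exact sum_pp m
  rw [Finset.sum_congr rfl h3, Finset.sum_const, smul_eq_mul, mul_comm]

/-- the composition attached to a permutation -/
def jt (l : PP n) (σ : Sn n) : Fin n → ℤ := fun i => (l.1.1 i : ℤ) + ((σ i : ℕ) : ℤ) - (i : ℤ)

/-- Jacobi-Trudi character as functional -/
noncomputable def chi (l : PP n) : GA (Sn n) →ₗ[ℂ] ℂ := ∑ σ : Sn n, sg σ • psi (jt l σ)

lemma chi_gof (l : PP n) (g : Sn n) : chi l (gof g) = ((irrChar n l.1 g : ℤ) : ℂ) := by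
  simp only [chi, LinearMap.sum_apply, LinearMap.smul_apply, psi_gof, irrChar, sg, jt, smul_eq_mul]
  push_cast
  rfl

lemma isCls_chi (l : PP n) : IsCls (chi l) := by
  intro g x
  simp only [chi, LinearMap.sum_apply, LinearMap.smul_apply, isCls_psi _ g x]

lemma inner_chi (l m : PP n) :
    ∑ g : Sn n, psi (comp m) (gof g) * chi l (gof g) = (n.factorial : ℂ) *
      ((GG n m.1.1 (fun i : Fin n => (l.1.1 i : ℤ) - (i : ℤ)) : ℤ) : ℂ) := by
  simp only [chi, LinearMap.sum_apply, LinearMap.smul_apply, psi_gof, GG, smul_eq_mul, Finset.mul_sum]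
  rw [Finset.sum_comm]
  push_cast
  rw [Finset.mul_sum]
  refine Finset.sum_congr rfl fun σ _ => ?_
  have h := inner_young (jt l σ) m
  have h' : (∑ g : Sn n, ((youngCount n (comp m) g : ℤ) : ℂ) * ((youngCount n (jt l σ) g : ℤ) : ℂ)) =
    (n.factorial : ℂ) * ((NN n m.1.1 (jt l σ) : ℤ) : ℂ) := by exact_mod_cast h
  have h2 : (fun i : Fin n => (l.1.1 i : ℤ) - (i : ℤ) + ((σ i : ℕ) : ℤ)) = jt l σ := by
    funext i; simp only [jt]; ring
  rw [h2, mul_left_comm, ← h', Finset.mul_sum]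
  refine Finset.sum_congr rfl fun g _ => ?_
  simp only [sg]
  ring

lemma youngCount_inv (a : Fin n → ℤ) (g : Sn n) : youngCount n a g⁻¹ = youngCount n a g := by
  rw [youngCount_eq, youngCount_eq]
  congr 3
  ext f
  apply and_congr _ Iff.rfl
  constructor
  · intro h
    funext t
    have := congrFun h (g t)
    simp at this ⊢
    exact this.symm
  · intro h
    funext t
    have := congrFun h (g⁻¹ t)
    simp at this ⊢
    exact this.symm

lemma psi_inv (a : Fin n → ℤ) (g : Sn n) : psi a (gof g⁻¹) = psi a (gof g) := by
  rw [psi_gof, psi_gof, youngCount_inv]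

lemma chi_inv (l : PP n) (g : Sn n) : chi l (gof g⁻¹) = chi l (gof g) := by
  simp only [chi, LinearMap.sum_apply, LinearMap.smul_apply, psi_inv]

/-- inner product via idempotents -/
lemma inner_lincomb (f h : GA (Sn n) →ₗ[ℂ] ℂ) (hf : IsCls f) (hh : IsCls h) :
    ∑ g : Sn n, f (gof g) * h (gof g⁻¹) = (n.factorial : ℂ) * ∑ r : PP n, f r.tab.e * h r.tab.e := by
  conv_lhs => rw [hh.eq_lincomb]
  simp only [lincomb, LinearMap.sum_apply, LinearMap.smul_apply, Finset.mul_sum]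
  rw [Finset.sum_comm]
  refine Finset.sum_congr rfl fun r _ => ?_
  have := ch_inner f hf r.tab.e
  rw [Fintype.card_perm, Fintype.card_fin] at this
  rw [mul_comm (f r.tab.e), mul_left_comm, ← this, Finset.mul_sum]
  refine Finset.sum_congr rfl fun g _ => ?_
  rw [smul_eq_mul]; ring

lemma pre_comp (l : PP n) (r : ℕ) : pre (comp l) r = (partialSum l.1 r : ℤ) := by
  by_cases h : r ≤ n
  · rw [pre, partialSum, Finset.sum_filter]
    simp only [comp]
    rw [Fin.sum_univ_eq_sum_range (fun i => if i < r then (l.1.1 i : ℤ) else 0), ← Finset.sum_filter]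
    push_cast
    apply Finset.sum_congr _ (fun _ _ => rfl)
    ext i; simp; omega
  · have h1 : partialSum l.1 r = n := by
      rw [ps_eq_size, l.2]
      apply zero_of_size_le; rw [l.2]; omega
    rw [h1, pre, Finset.filter_true_of_mem]
    · simp only [comp]
      exact_mod_cast sum_pp l
    · intro i _; have := i.2; omega

/-- prefix sums of a permutation dominate those of the identity -/
lemma pre_perm (σ : Sn n) (r : ℕ) : (∑ i ∈ Finset.univ.filter (fun i : Fin n => (i : ℕ) < r), ((i : ℕ) : ℤ)) ≤
    ∑ i ∈ Finset.univ.filter (fun i : Fin n => (i : ℕ) < r), ((σ i : ℕ) : ℤ) := by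
  set S := Finset.univ.filter (fun i : Fin n => (i : ℕ) < r)
  have h1 : ∑ i ∈ S, ((σ i : ℕ) : ℤ) = ∑ j ∈ S.image σ, ((j : ℕ) : ℤ) := by
    rw [Finset.sum_image (fun a _ b _ h => σ.injective h)]
  rw [h1]
  set T := S.image σ
  have hcard : T.card = S.card := Finset.card_image_of_injective _ σ.injective
  have h2 : (S \ T).card = (T \ S).card := by
    have a := Finset.card_sdiff_add_card_inter S T
    have b := Finset.card_sdiff_add_card_inter T S
    rw [Finset.inter_comm] at b
    omega
  have h3 : ∑ i ∈ S \ T, ((i : ℕ) : ℤ) ≤ ∑ i ∈ T \ S, ((i : ℕ) : ℤ) := by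
    calc _ ≤ ∑ i ∈ S \ T, (r : ℤ) := by
          apply Finset.sum_le_sum
          intro i hi
          have := (Finset.mem_sdiff.1 hi).1
          simp only [S, Finset.mem_filter, Finset.mem_univ, true_and] at this
          omega
      _ = ∑ i ∈ T \ S, (r : ℤ) := by rw [Finset.sum_const, Finset.sum_const, h2]
      _ ≤ _ := by
          apply Finset.sum_le_sum
          intro i hi
          have := (Finset.mem_sdiff.1 hi).2
          simp only [S, Finset.mem_filter, Finset.mem_univ, true_and] at this
          omega
  have a := Finset.sum_inter_add_sum_sdiff S T (fun i : Fin n => ((i : ℕ) : ℤ))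
  have b := Finset.sum_inter_add_sum_sdiff T S (fun i : Fin n => ((i : ℕ) : ℤ))
  rw [Finset.inter_comm] at b
  linarith

lemma pre_jt (l : PP n) (σ : Sn n) (r : ℕ) : pre (jt l σ) r = (partialSum l.1 r : ℤ) +
    (∑ i ∈ Finset.univ.filter (fun i : Fin n => (i : ℕ) < r), ((σ i : ℕ) : ℤ)) -
    ∑ i ∈ Finset.univ.filter (fun i : Fin n => (i : ℕ) < r), ((i : ℕ) : ℤ) := by
  rw [← pre_comp]
  simp only [pre, jt, comp, Finset.sum_add_distrib, Finset.sum_sub_distrib]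

lemma perm_eq_one (σ : Sn n) (h : ∀ r, ∑ i ∈ Finset.univ.filter (fun i : Fin n => (i : ℕ) < r), ((σ i : ℕ) : ℤ) =
    ∑ i ∈ Finset.univ.filter (fun i : Fin n => (i : ℕ) < r), ((i : ℕ) : ℤ)) : σ = 1 := by
  ext i
  have h1 := h i
  have h2 := h (i + 1)
  have h3 : Finset.univ.filter (fun j : Fin n => (j : ℕ) < i + 1) =
      insert i (Finset.univ.filter (fun j : Fin n => (j : ℕ) < i)) := by
    ext j; simp [Fin.ext_iff]; omega
  rw [h3, Finset.sum_insert (by simp), Finset.sum_insert (by simp)] at h2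
  simp only [Equiv.Perm.coe_one, id]
  omega

lemma chi_e_self (l : PP n) : chi l l.tab.e = 1 := by
  rw [chi, LinearMap.sum_apply, Finset.sum_eq_single 1]
  · have : jt l 1 = comp l := by funext i; simp [jt, comp]
    rw [LinearMap.smul_apply, this, psi_e_self]; simp [sg]
  · intro σ _ hσ
    have : ∃ r, (partialSum l.1 r : ℤ) < pre (jt l σ) r := by
      by_contra hx
      push Not at hx
      apply hσ
      apply perm_eq_one
      intro r
      have h1 := hx r
      have h2 := pre_perm σ r
      rw [pre_jt] at h1
      linarith
    obtain ⟨r, hr⟩ := this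
    rw [LinearMap.smul_apply, psi_e_zero hr, smul_zero]
  · simp

lemma chi_e_zero {l m : PP n} {r : ℕ} (h : partialSum m.1 r < partialSum l.1 r) : chi l m.tab.e = 0 := by
  rw [chi, LinearMap.sum_apply]
  apply Finset.sum_eq_zero
  intro σ _
  rw [LinearMap.smul_apply, psi_e_zero (r := r), smul_zero]
  rw [pre_jt]
  have := pre_perm σ r
  omega

lemma psi_comp_e_zero {l m : PP n} {r : ℕ} (h : partialSum m.1 r < partialSum l.1 r) :
    psi (comp l) m.tab.e = 0 := by
  apply psi_e_zero (r := r)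
  rw [pre_comp]
  omega

lemma chi_e_ne {l m : PP n} (h : l ≠ m) : chi l m.tab.e = 0 := by
  by_contra hne
  -- choose a maximal counterexample
  let wt : PP n → ℕ := fun m => ∑ r ∈ Finset.range (n + 1), partialSum m.1 r
  obtain ⟨q, hq, hmax⟩ := Finset.exists_max_image (Finset.univ.filter (fun m : PP n => l ≠ m ∧ chi l m.tab.e ≠ 0))
    wt ⟨m, by simp [h, hne]⟩
  simp only [Finset.mem_filter, Finset.mem_univ, true_and] at hq hmax
  obtain ⟨hlq, hq⟩ := hq
  have hdom : ∀ r, partialSum l.1 r ≤ partialSum q.1 r := by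
    intro r
    by_contra hx
    push Not at hx
    exact hq (chi_e_zero hx)
  have h1 := inner_lincomb (psi (comp q)) (chi l) (isCls_psi _) (isCls_chi l)
  simp only [chi_inv] at h1
  rw [inner_chi] at h1
  have hz : GG n q.1.1 (fun i : Fin n => (l.1.1 i : ℤ) - (i : ℤ)) = 0 := by
    have hex : ∃ i, l.1.1 i ≠ q.1.1 i := by
      by_contra hx
      push Not at hx
      apply hlq
      apply Subtype.ext
      apply Subtype.ext
      ext i
      exact hx i
    let j := Nat.find hex
    have hj : l.1.1 j ≠ q.1.1 j := Nat.find_spec hex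
    have hlt : ∀ i < j, q.1.1 i = l.1.1 i := by
      intro i hi
      have := Nat.find_min hex hi
      push Not at this
      exact this.symm
    have hps : partialSum q.1 j = partialSum l.1 j :=
      Finset.sum_congr rfl (fun i hi => hlt i (Finset.mem_range.1 hi))
    have hd := hdom (j + 1)
    rw [ps_succ, ps_succ, hps] at hd
    apply lex_vanish j n (fun i => l.1.1 i) (fun i => q.1.1 i) (fun a b hab => l.1.2 hab) _ _ hlt _
    · apply zero_of_size_le; rw [l.2]
    · by_contra hx
      apply hj
      rw [zero_of_size_le l.1 (by rw [l.2]; omega), zero_of_size_le q.1 (by rw [q.2]; omega)]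
    · change l.1.1 j < q.1.1 j
      omega
  rw [hz] at h1
  have h2 : ∑ r : PP n, psi (comp q) r.tab.e * chi l r.tab.e = chi l q.tab.e := by
    rw [Finset.sum_eq_single q]
    · rw [psi_e_self, one_mul]
    · intro r _ hrq
      by_cases hd : ∃ s, partialSum r.1 s < partialSum q.1 s
      · obtain ⟨s, hs⟩ := hd
        rw [psi_comp_e_zero hs, zero_mul]
      · push Not at hd
        by_cases hlr : l = r
        · exfalso
          subst hlr
          apply hlq
          apply Subtype.ext
          apply ext_ps
          intro s
          have := hd s
          have := hdom s
          omega
        · by_cases hc : chi l r.tab.e = 0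
          · rw [hc, mul_zero]
          · exfalso
            have h3 := hmax r ⟨hlr, hc⟩
            apply hrq
            apply Subtype.ext
            have h4 : ∀ s ∈ Finset.range (n + 1), partialSum q.1 s = partialSum r.1 s :=
              (Finset.sum_eq_sum_iff_of_le (fun s _ => hd s)).1
                (le_antisymm (Finset.sum_le_sum fun s _ => hd s) h3)
            apply ext_ps
            intro s
            by_cases hs : s ≤ n
            · exact (h4 s (by simp; omega)).symm
            · rw [ps_eq_size r.1 (zero_of_size_le _ (by rw [r.2]; omega)),
                ps_eq_size q.1 (zero_of_size_le _ (by rw [q.2]; omega)), r.2, q.2]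
    · simp
  rw [h2] at h1
  have hf : (n.factorial : ℂ) ≠ 0 := by exact_mod_cast n.factorial_ne_zero
  have : chi l q.tab.e = 0 := by
    simp only [Int.cast_zero, mul_zero] at h1
    rcases mul_eq_zero.1 h1.symm with h | h
    · exact absurd h hf
    · exact h
  exact hq this

lemma chi_eq (l : PP n) : chi l = ch l.tab.e := by
  rw [(isCls_chi l).eq_lincomb, lincomb, Finset.sum_eq_single l]
  · rw [chi_e_self, one_smul]
  · intro r _ hr
    rw [chi_e_ne (Ne.symm hr), zero_smul]
  · simp

lemma irrChar_eq (l : PP n) (g : Sn n) : ((irrChar n l.1 g : ℤ) : ℂ) = ch l.tab.e (gof g) := by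
  rw [← chi_gof, chi_eq]

lemma ch_e_inv (l : PP n) (g : Sn n) : ch l.tab.e (gof g⁻¹) = ch l.tab.e (gof g) := by
  rw [← chi_eq, chi_inv]

end Mat
end KP

open scoped BigOperators
open scoped Classical
open scoped TensorProduct DirectSum
set_option linter.unusedSectionVars false

namespace KP
open Partition'

section Prod
variable {n : ℕ}

/-- The group algebra of the product. -/
abbrev BB (n : ℕ) := GA (Sn n × Sn n)

/-- left embedding -/
noncomputable def inlB : GA (Sn n) →ₐ[ℂ] BB n :=
  MonoidAlgebra.mapDomainAlgHom ℂ ℂ (MonoidHom.inl (Sn n) (Sn n))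
/-- right embedding -/
noncomputable def inrB : GA (Sn n) →ₐ[ℂ] BB n :=
  MonoidAlgebra.mapDomainAlgHom ℂ ℂ (MonoidHom.inr (Sn n) (Sn n))
/-- diagonal embedding -/
noncomputable def diB : GA (Sn n) →ₐ[ℂ] BB n :=
  MonoidAlgebra.mapDomainAlgHom ℂ ℂ ((MonoidHom.id (Sn n)).prod (MonoidHom.id (Sn n)))

lemma inlB_gof (g : Sn n) : inlB (gof g) = gof (g, 1) := by
  simp [inlB, gof, MonoidAlgebra.mapDomain_single]
lemma inrB_gof (g : Sn n) : inrB (gof g) = gof (1, g) := by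
  simp [inrB, gof, MonoidAlgebra.mapDomain_single]
lemma diB_gof (g : Sn n) : diB (gof g) = gof (g, g) := by
  simp [diB, gof, MonoidAlgebra.mapDomain_single]

lemma lr_comm (x y : GA (Sn n)) : inrB y * inlB x = inlB x * inrB y := by
  induction x using ind_gof with
  | h0 g =>
    induction y using ind_gof with
    | h0 h => simp [inlB_gof, inrB_gof, ← gof_mul]
    | hz => simp
    | ha x y hx hy => simp [mul_add, add_mul, hx, hy]
    | hs c x hx => simp [hx]
  | hz => simp
  | ha x y hx hy => simp [mul_add, add_mul, hx, hy]
  | hs c x hx => simp [hx]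

lemma lr_mul (x y x' y' : GA (Sn n)) :
    (inlB x * inrB y) * (inlB x' * inrB y') = inlB (x * x') * inrB (y * y') := by
  rw [map_mul, map_mul, show inlB x * inrB y * (inlB x' * inrB y') =
    inlB x * (inrB y * inlB x') * inrB y' by simp only [mul_assoc], lr_comm]
  simp only [mul_assoc]

lemma gof_pair (g h : Sn n) : gof (g, h) = inlB (gof g) * inrB (gof h) := by
  rw [inlB_gof, inrB_gof, ← gof_mul]; simp

/-- product idempotents -/
noncomputable def eps (p : PP n × PP n) : BB n := inlB p.1.tab.e * inrB p.2.tab.e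

lemma eps_idem (p : PP n × PP n) : eps p * eps p = eps p := by
  rw [eps, lr_mul, Tab.e_idem, Tab.e_idem]

lemma eps_orth {p q : PP n × PP n} (h : p ≠ q) (x : BB n) : eps p * x * eps q = 0 := by
  induction x using ind_gof with
  | h0 g =>
    obtain ⟨a, b⟩ := g
    rw [gof_pair, eps, eps, lr_mul, lr_mul]
    by_cases h1 : p.1 = q.1
    · have h2 : p.2 ≠ q.2 := fun h2 => h (Prod.ext h1 h2)
      rw [e_orth h2, map_zero, mul_zero]
    · rw [e_orth h1, map_zero, zero_mul]
  | hz => simp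
  | ha x y hx hy => simp [mul_add, add_mul, hx, hy]
  | hs c x hx => simp [hx]

lemma eps_scal (p : PP n × PP n) (x : BB n) : ∃ c : ℂ, eps p * x * eps p = c • eps p := by
  induction x using ind_gof with
  | h0 g =>
    obtain ⟨a, b⟩ := g
    obtain ⟨k, hk⟩ := p.1.tab.e_mul_e (gof a)
    obtain ⟨k', hk'⟩ := p.2.tab.e_mul_e (gof b)
    refine ⟨k * k', ?_⟩
    rw [gof_pair, eps, lr_mul, lr_mul, hk, hk', map_smul, map_smul, smul_mul_smul_comm]
  | hz => exact ⟨0, by simp⟩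
  | ha x y hx hy =>
    obtain ⟨a, ha⟩ := hx
    obtain ⟨b, hb⟩ := hy
    exact ⟨a + b, by rw [mul_add, add_mul, ha, hb, add_smul]⟩
  | hs c x hx =>
    obtain ⟨a, ha⟩ := hx
    exact ⟨c * a, by rw [mul_smul_comm, smul_mul_assoc, ha, mul_smul]⟩

lemma one_span : (1 : BB n) ∈ Submodule.span ℂ
    (Set.range fun t : BB n × (PP n × PP n) × BB n => t.1 * eps t.2.1 * t.2.2) := by
  have h1 : (1 : BB n) = inlB (1 : GA (Sn n)) * inrB (1 : GA (Sn n)) := by simp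
  rw [h1, one_eq, map_sum, map_sum, Finset.sum_mul_sum]
  refine Submodule.sum_mem _ fun r _ => Submodule.sum_mem _ fun s _ => ?_
  rw [map_sum, map_sum, Finset.sum_mul_sum]
  refine Submodule.sum_mem _ fun g _ => Submodule.sum_mem _ fun h _ => ?_
  rw [← lr_mul, ← lr_mul]
  exact Submodule.subset_span ⟨⟨_, (r, s), _⟩, rfl⟩

lemma tau_lr (x y : GA (Sn n)) : tau (inlB x * inrB y) = tau x * tau y := by
  induction x using ind_gof with
  | h0 g =>
    induction y using ind_gof with
    | h0 h =>
      rw [← gof_pair, tau_gof, tau_gof, tau_gof]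
      by_cases h1 : g = 1 <;> by_cases h2 : h = 1 <;> simp [h1, h2]
    | hz => simp
    | ha x y hx hy => simp [mul_add, hx, hy]
    | hs c x hx => simp [hx]; ring
  | hz => simp
  | ha x y hx hy => simp [add_mul, hx, hy]
  | hs c x hx => simp [hx]; ring

lemma ch_eps (p : PP n × PP n) (g h : Sn n) :
    ch (eps p) (gof (g, h)) = ch p.1.tab.e (gof g) * ch p.2.tab.e (gof h) := by
  rw [ch_apply, ch_apply, ch_apply, Finset.sum_mul_sum, Fintype.sum_prod_type]
  refine Finset.sum_congr rfl fun a _ => Finset.sum_congr rfl fun b _ => ?_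
  rw [Prod.inv_mk, gof_pair, gof_pair, gof_pair, eps, lr_mul, lr_mul, lr_mul, tau_lr]

/-- the projection `y ↦ E y ε` -/
noncomputable def prj (r : PP n) (p : PP n × PP n) : BB n →ₗ[ℂ] BB n :=
  LinearMap.mulRight ℂ (eps p) ∘ₗ LinearMap.mulLeft ℂ (diB r.tab.e)

lemma prj_apply (r : PP n) (p : PP n × PP n) (y : BB n) :
    prj r p y = diB r.tab.e * y * eps p := rfl

lemma di_idem (r : PP n) : diB r.tab.e * diB r.tab.e = diB r.tab.e := by
  rw [← map_mul, Tab.e_idem]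

lemma prj_idem (r : PP n) (p : PP n × PP n) : IsIdempotentElem (prj r p) := by
  refine LinearMap.ext fun y => ?_
  rw [Module.End.mul_apply, prj_apply, prj_apply]
  rw [show diB r.tab.e * (diB r.tab.e * y * eps p) * eps p =
    (diB r.tab.e * diB r.tab.e) * y * (eps p * eps p) by simp only [mul_assoc], di_idem, eps_idem]

lemma finrank_prj (r : PP n) (p : PP n × PP n) :
    (Module.finrank ℂ (LinearMap.range (prj r p)) : ℂ) = ch (eps p) (diB r.tab.e) := by
  rw [← trace_lr]
  exact ((LinearMap.isProj_range_iff_isIdempotentElem _).2 (prj_idem r p)).trace.symm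

lemma card_mul_finrank (r : PP n) (p : PP n × PP n) :
    (n.factorial : ℂ) * Module.finrank ℂ (LinearMap.range (prj r p)) =
      ∑ g : Sn n, (irrChar n p.1.1 g : ℂ) * irrChar n p.2.1 g * irrChar n r.1 g := by
  have h := ch_inner (G := Sn n) (ch (eps p) ∘ₗ diB.toLinearMap) (fun g x => by
    simp only [LinearMap.comp_apply, AlgHom.toLinearMap_apply, map_mul, diB_gof]
    rw [← Prod.inv_mk, ch_conj]) r.tab.e
  simp only [LinearMap.comp_apply, AlgHom.toLinearMap_apply, diB_gof, ch_eps] at h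
  rw [finrank_prj, show (n.factorial : ℂ) = (Fintype.card (Sn n) : ℂ) by
    rw [Fintype.card_perm, Fintype.card_fin], ← h]
  refine Finset.sum_congr rfl fun g _ => ?_
  rw [irrChar_eq, irrChar_eq, irrChar_eq, ch_e_inv]

lemma kron_eq (l m nu : Partition') (hl : size l = size nu) (hm : size m = size nu) :
    kron l m nu = Module.finrank ℂ (LinearMap.range (prj (n := size nu) ⟨nu, rfl⟩ (⟨l, hl⟩, ⟨m, hm⟩))) := by
  have h := card_mul_finrank (n := size nu) ⟨nu, rfl⟩ (⟨l, hl⟩, ⟨m, hm⟩)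
  set d := Module.finrank ℂ (LinearMap.range (prj (n := size nu) ⟨nu, rfl⟩ (⟨l, hl⟩, ⟨m, hm⟩)))
  have h2 : ((size nu).factorial : ℤ) * d = ∑ g : Equiv.Perm (Fin (size nu)),
        irrChar (size nu) l g * irrChar (size nu) m g * irrChar (size nu) nu g := by
    exact_mod_cast h
  rw [kron, if_pos ⟨hl, hm⟩, ← h2, Int.mul_ediv_cancel_left _ (by exact_mod_cast Nat.factorial_ne_zero _)]
  simp

lemma kron_ne {l m nu : Partition'} (h : kron l m nu ≠ 0) : size l = size nu ∧ size m = size nu := by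
  by_contra hc
  exact h (if_neg hc)

end Prod
end KP

open scoped BigOperators
open scoped Classical
open scoped TensorProduct DirectSum
set_option linter.unusedSectionVars false

namespace KP

section Gen
theorem gen_inj {B T : Type*}
    [Ring B]
    [Algebra ℂ B]
    [AddCommGroup T]
    [Module ℂ T]
    (ρ : B →ₐ[ℂ] Module.End ℂ T)
    {ι J : Type*}
    [DecidableEq J]
    (ε : ι → B)
    (hid : ∀ i, ε i * ε i = ε i)
    (hor : ∀ i j, i ≠ j → ∀ x, ε i * x * ε j = 0)
    (hsc : ∀ i x, ∃ c : ℂ, ε i * x * ε i = c • ε i)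
    (hone : (1 : B) ∈ Submodule.span ℂ (Set.range fun t : B × ι × B => t.1 * ε t.2.1 * t.2.2))
    (i : J → ι)
    (w : J → B)
    (hw : ∀ j, w j * ε (i j) = w j)
    (hli : ∀ k (s : Finset J) (a : J → ℂ), (∀ j, i j ≠ k → a j = 0) → ∑ j ∈ s, a j • w j = 0 →
    ∀ j ∈ s, a j = 0)
    {Q : J → Type*}
    [∀ j, AddCommGroup (Q j)]
    [∀ j, Module ℂ (Q j)]
    (q : ∀ j, Q j →ₗ[ℂ] T)
    (hqi : ∀ j, Function.Injective (q j))
    (hqr : ∀ j, LinearMap.range (q j) = LinearMap.range (ρ (ε (i j)))) : Function.Injective (DirectSum.toModule ℂ J T (fun j => ρ (w j) ∘ₗ q j)) := by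
  rw [injective_iff_map_eq_zero]
  intro x hx
  have hx2 : ∑ j ∈ DFinsupp.support x, ρ (w j) (q j (x j)) = 0 := by
    rw [← hx]
    conv_rhs => rw [← DirectSum.sum_support_of x, map_sum]
    refine Finset.sum_congr rfl fun j _ => ?_
    rw [← DirectSum.lof_eq_of ℂ, DirectSum.toModule_lof, LinearMap.comp_apply]
  have hy : ∀ j, ρ (ε (i j)) (q j (x j)) = q j (x j) := by
    intro j
    have : q j (x j) ∈ LinearMap.range (ρ (ε (i j))) := by rw [← hqr]; exact ⟨_, rfl⟩
    obtain ⟨z, hz⟩ := this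
    rw [← hz, ← Module.End.mul_apply, ← map_mul, hid]
  have key : ∀ k (ψ : Module.Dual ℂ T), ∀ j ∈ DFinsupp.support x, (if i j = k then ψ (q j (x j)) else 0) = 0 := by
    intro k ψ
    apply hli k _ (fun j => if i j = k then ψ (q j (x j)) else 0)
    · intro j hj
      rw [if_neg hj]
    set w' := ∑ j ∈ DFinsupp.support x, (if i j = k then ψ (q j (x j)) else 0) • w j with hw'
    have hwk : w' * ε k = w' := by
      rw [hw', Finset.sum_mul]
      refine Finset.sum_congr rfl fun j _ => ?_
      split_ifs with h
      · rw [smul_mul_assoc, ← h, hw]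
      · simp
    have h1 : ∀ b, ε k * b * w' = 0 := by
      intro b
      choose c hc using fun j => hsc k (b * w j)
      have h2 : ∑ j ∈ DFinsupp.support x, (if i j = k then c j • q j (x j) else 0) = 0 := by
        have h3 := congrArg (ρ (ε k * b)) hx2
        rw [map_zero, map_sum] at h3
        refine Eq.trans (Finset.sum_congr rfl fun j _ => ?_) h3
        have h4 : ρ (ε k * b) (ρ (w j) (q j (x j))) = ρ (ε k * (b * w j) * ε (i j)) (q j (x j)) := by
          conv_lhs => rw [← hw j]
          rw [← Module.End.mul_apply, ← map_mul]
          simp only [mul_assoc]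
        rw [h4]
        split_ifs with h
        · subst h
          rw [hc, map_smul, LinearMap.smul_apply, hy]
        · rw [hor _ _ (Ne.symm h), map_zero, LinearMap.zero_apply]
      have h5 := congrArg ψ h2
      rw [map_sum, map_zero] at h5
      have h6 : ε k * b * w' = (∑ j ∈ DFinsupp.support x, ψ (if i j = k then c j • q j (x j) else 0)) • ε k := by
        rw [← hwk, hw', Finset.sum_mul, Finset.mul_sum, Finset.sum_smul]
        refine Finset.sum_congr rfl fun j _ => ?_
        split_ifs with h
        · rw [smul_mul_assoc, mul_smul_comm, show ε k * b * (w j * ε k) = ε k * (b * w j) * ε k by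
            simp only [mul_assoc], hc, map_smul, smul_smul, smul_eq_mul, mul_comm]
        · simp
      rw [h6, h5, zero_smul]
    have h7 : ∀ z ∈ Submodule.span ℂ (Set.range fun t : B × ι × B => t.1 * ε t.2.1 * t.2.2), z * w' = 0 := by
      intro z hz
      induction hz using Submodule.span_induction with
      | mem z hz =>
        obtain ⟨⟨a, l, a'⟩, rfl⟩ := hz
        simp only
        rw [show a * ε l * a' * w' = a * (ε l * a' * w') by simp only [mul_assoc]]
        by_cases hl : l = k
        · rw [hl, h1, mul_zero]
        · rw [← hwk, ← mul_assoc (ε l * a'), mul_assoc (ε l), hor _ _ hl, mul_zero]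
      | zero => simp
      | add a b _ _ ha hb => rw [add_mul, ha, hb, add_zero]
      | smul c a _ ha => rw [smul_mul_assoc, ha, smul_zero]
    have := h7 1 hone
    rwa [one_mul] at this
  by_contra hne
  obtain ⟨j, hj⟩ : ∃ j, x j ≠ 0 := by
    by_contra hcon
    push Not at hcon
    exact hne (DFinsupp.ext hcon)
  apply hj
  apply hqi j
  rw [map_zero]
  rw [← Module.forall_dual_apply_eq_zero_iff ℂ]
  intro ψ
  have := key (i j) ψ j (DFinsupp.mem_support_iff.2 hj)
  rwa [if_pos rfl] at this

theorem gen_range {B T : Type*}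
    [Ring B]
    [Algebra ℂ B]
    [AddCommGroup T]
    [Module ℂ T]
    (ρ : B →ₐ[ℂ] Module.End ℂ T)
    {ι J : Type*}
    [DecidableEq J]
    (ε : ι → B)
    (hid : ∀ i, ε i * ε i = ε i)
    (hone : (1 : B) ∈ Submodule.span ℂ (Set.range fun t : B × ι × B => t.1 * ε t.2.1 * t.2.2))
    (E : B)
    (i : J → ι)
    (w : J → B)
    (hE : ∀ j, E * w j = w j)
    (hw : ∀ j, w j * ε (i j) = w j)
    (hspan : ∀ b k, E * b * ε k ∈ Submodule.span ℂ (w '' {j | i j = k}))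
    {Q : J → Type*}
    [∀ j, AddCommGroup (Q j)]
    [∀ j, Module ℂ (Q j)]
    (q : ∀ j, Q j →ₗ[ℂ] T)
    (hqr : ∀ j, LinearMap.range (q j) = LinearMap.range (ρ (ε (i j)))) : LinearMap.range (DirectSum.toModule ℂ J T (fun j => ρ (w j) ∘ₗ q j)) =
    LinearMap.range (ρ E) := by
  apply le_antisymm
  · rintro _ ⟨x, rfl⟩
    induction x using DirectSum.induction_on with
    | zero => simp
    | of j x =>
      rw [← DirectSum.lof_eq_of ℂ, DirectSum.toModule_lof, LinearMap.comp_apply, ← hE j, map_mul]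
      exact ⟨_, rfl⟩
    | add x y hx hy => rw [map_add]; exact Submodule.add_mem _ hx hy
  · rintro _ ⟨t, rfl⟩
    set R := LinearMap.range (DirectSum.toModule ℂ J T (fun j => ρ (w j) ∘ₗ q j))
    have h1 : ∀ j s, ρ (w j) s ∈ R := by
      intro j s
      have : ρ (ε (i j)) s ∈ LinearMap.range (q j) := by rw [hqr]; exact ⟨_, rfl⟩
      obtain ⟨z, hz⟩ := this
      refine ⟨DirectSum.lof ℂ J Q j z, ?_⟩
      rw [DirectSum.toModule_lof, LinearMap.comp_apply, hz, ← Module.End.mul_apply, ← map_mul, hw]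
    have h2 : ∀ k, ∀ u ∈ Submodule.span ℂ (w '' {j | i j = k}), ∀ s, ρ u s ∈ R := by
      intro k u hu s
      induction hu using Submodule.span_induction with
      | mem z hz => obtain ⟨j, _, rfl⟩ := hz; exact h1 j s
      | zero => simp
      | add a b _ _ ha hb => rw [map_add]; exact Submodule.add_mem _ ha hb
      | smul c a _ ha => rw [map_smul]; exact Submodule.smul_mem _ _ ha
    have h7 : ∀ z ∈ Submodule.span ℂ (Set.range fun t : B × ι × B => t.1 * ε t.2.1 * t.2.2),
        ρ (E * z) t ∈ R := by
      intro z hz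
      induction hz using Submodule.span_induction with
      | mem z hz =>
        obtain ⟨⟨a, l, a'⟩, rfl⟩ := hz
        simp only
        rw [show E * (a * ε l * a') = (E * a * ε l) * a' by simp only [mul_assoc], map_mul,
          Module.End.mul_apply]
        exact h2 l _ (hspan _ _) _
      | zero => simp
      | add a b _ _ ha hb => rw [mul_add, map_add]; exact Submodule.add_mem _ ha hb
      | smul c a _ ha => rw [mul_smul_comm, map_smul]; exact Submodule.smul_mem _ _ ha
    have := h7 1 hone
    rwa [mul_one] at this

end Gen
end KP

open scoped BigOperators
open scoped Classical
open scoped TensorProduct DirectSum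
set_option linter.unusedSectionVars false

namespace KP
open Partition'

section Act
variable {n : ℕ} {V W : Type} [AddCommGroup V] [Module ℂ V] [AddCommGroup W] [Module ℂ W]

/-- tensor power -/
abbrev TP (n : ℕ) (V : Type) [AddCommGroup V] [Module ℂ V] := PiTensorProduct ℂ (fun _ : Fin n => V)

lemma permAction_tprod (σ : Sn n) (f : Fin n → V) :
    permAction ℂ n V σ (PiTensorProduct.tprod ℂ f) = PiTensorProduct.tprod ℂ (fun i => f (σ.symm i)) := by
  rw [permAction]
  exact PiTensorProduct.reindex_tprod σ f

lemma tpow_tprod (g : V →ₗ[ℂ] V) (f : Fin n → V) :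
    tpow ℂ n g (PiTensorProduct.tprod ℂ f) = PiTensorProduct.tprod ℂ (fun i => g (f i)) := by
  rw [tpow]
  exact PiTensorProduct.map_tprod _ f

/-- the permutation representation -/
noncomputable def permHom (n : ℕ) (V : Type) [AddCommGroup V] [Module ℂ V] :
    Sn n →* Module.End ℂ (TP n V) where
  toFun σ := permAction ℂ n V σ
  map_one' := by
    refine PiTensorProduct.ext (MultilinearMap.ext fun f => ?_)
    simp only [LinearMap.compMultilinearMap_apply]
    rw [permAction_tprod]; rfl
  map_mul' σ τ := by
    refine PiTensorProduct.ext (MultilinearMap.ext fun f => ?_)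
    simp only [LinearMap.compMultilinearMap_apply]
    rw [Module.End.mul_apply, permAction_tprod, permAction_tprod, permAction_tprod]; rfl

/-- action of group algebra -/
noncomputable def act (n : ℕ) (V : Type) [AddCommGroup V] [Module ℂ V] :
    GA (Sn n) →ₐ[ℂ] Module.End ℂ (TP n V) := MonoidAlgebra.lift ℂ _ _ (permHom n V)

lemma act_gof (σ : Sn n) : act n V (gof σ) = permAction ℂ n V σ := by
  rw [act, gof, MonoidAlgebra.lift_single, one_smul]; rfl

lemma tpow_perm (g : V →ₗ[ℂ] V) (σ : Sn n) :
    tpow ℂ n g ∘ₗ permAction ℂ n V σ = permAction ℂ n V σ ∘ₗ tpow ℂ n g := by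
  refine PiTensorProduct.ext (MultilinearMap.ext fun f => ?_)
  simp only [LinearMap.compMultilinearMap_apply, LinearMap.comp_apply]
  rw [permAction_tprod, tpow_tprod, tpow_tprod, permAction_tprod]

lemma tpow_act (g : V →ₗ[ℂ] V) (x : GA (Sn n)) :
    tpow ℂ n g ∘ₗ act n V x = act n V x ∘ₗ tpow ℂ n g := by
  induction x using ind_gof with
  | h0 σ => rw [act_gof, tpow_perm]
  | hz => simp
  | ha x y hx hy => rw [map_add, LinearMap.comp_add, LinearMap.add_comp, hx, hy]
  | hs c x hx => rw [map_smul, LinearMap.comp_smul, LinearMap.smul_comp, hx]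

lemma young_eq (l : Partition') : youngSymmetrizer ℂ l V = act (size l) V (tabOf l rfl).c := by
  rw [youngSymmetrizer, Tab.c, map_mul, symA, symB, map_sum, map_sum]
  simp only [map_smul, act_gof]
  rw [Module.End.mul_eq_comp]
  congr 1
  · refine Finset.sum_congr ?_ fun _ _ => rfl
    ext σ
    simp [mem_stabF, tabOf]
  · refine Finset.sum_congr ?_ fun _ _ => rfl
    ext σ
    simp [mem_stabF, tabOf]

lemma schur_eq (l : Partition') : schur ℂ l V = LinearMap.range (act (size l) V (tabOf l rfl).e) := by
  rw [schur, young_eq, Tab.c_eq, map_smul, LinearMap.range_smul _ _ (Tab.k_ne _)]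

lemma schur_inv (l : Partition') (g : V →ₗ[ℂ] V) :
    ∀ x ∈ schur ℂ l V, tpow ℂ (size l) g x ∈ schur ℂ l V := by
  intro x hx
  rw [schur_eq] at *
  obtain ⟨y, rfl⟩ := hx
  rw [← LinearMap.comp_apply, tpow_act]
  exact ⟨_, rfl⟩

/-- inclusion of the Schur module -/
noncomputable def incl (l : Partition') (h : size l = n) (V : Type) [AddCommGroup V] [Module ℂ V] :
    schur ℂ l V →ₗ[ℂ] TP n V :=
  (PiTensorProduct.reindex ℂ (fun _ : Fin (size l) => V) (finCongr h)).toLinearMap ∘ₗ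
    (schur ℂ l V).subtype

lemma incl_inj (l : Partition') (h : size l = n) : Function.Injective (incl l h V) := by
  rw [incl, LinearMap.coe_comp]
  exact (LinearEquiv.injective _).comp (Submodule.subtype_injective _)

lemma incl_range (l : Partition') (h : size l = n) :
    LinearMap.range (incl l h V) = LinearMap.range (act n V (tabOf l h).e) := by
  subst h
  rw [← schur_eq, incl]
  have : (PiTensorProduct.reindex ℂ (fun _ : Fin (size l) => V) (finCongr rfl)).toLinearMap =
      LinearMap.id := by
    have h2 : finCongr (rfl : size l = size l) = Equiv.refl _ := by ext; rfl
    rw [h2, PiTensorProduct.reindex_refl]; rfl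
  rw [this, LinearMap.id_comp, Submodule.range_subtype]

lemma incl_tpow (l : Partition') (h : size l = n) (g : V →ₗ[ℂ] V) (hg) :
    tpow ℂ n g ∘ₗ incl l h V = incl l h V ∘ₗ (tpow ℂ (size l) g).restrict hg := by
  refine LinearMap.ext fun x => ?_
  simp only [LinearMap.comp_apply, incl, LinearEquiv.coe_coe, Submodule.subtype_apply,
    LinearMap.coe_restrict_apply]
  exact PiTensorProduct.map_reindex (fun _ : Fin (size l) => g) (finCongr h) _

/-- the double action -/
noncomputable def permHom2 (n : ℕ) (V W : Type) [AddCommGroup V] [Module ℂ V] [AddCommGroup W] [Module ℂ W] :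
    Sn n × Sn n →* Module.End ℂ (TP n V ⊗[ℂ] TP n W) where
  toFun σ := TensorProduct.map (permHom n V σ.1) (permHom n W σ.2)
  map_one' := by
    rw [Prod.fst_one, Prod.snd_one, map_one, map_one, TensorProduct.map_one]
  map_mul' σ τ := by
    rw [Prod.fst_mul, Prod.snd_mul, map_mul, map_mul, TensorProduct.map_mul]

/-- action of double group algebra -/
noncomputable def actB (n : ℕ) (V W : Type) [AddCommGroup V] [Module ℂ V] [AddCommGroup W] [Module ℂ W] :
    BB n →ₐ[ℂ] Module.End ℂ (TP n V ⊗[ℂ] TP n W) := MonoidAlgebra.lift ℂ _ _ (permHom2 n V W)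

lemma actB_gof (σ τ : Sn n) : actB n V W (gof (σ, τ)) =
    TensorProduct.map (permAction ℂ n V σ) (permAction ℂ n W τ) := by
  rw [actB, gof, MonoidAlgebra.lift_single, one_smul]; rfl

lemma actB_lr (x y : GA (Sn n)) : actB n V W (inlB x * inrB y) =
    TensorProduct.map (act n V x) (act n W y) := by
  induction x using ind_gof with
  | h0 g =>
    induction y using ind_gof with
    | h0 h => rw [← gof_pair, actB_gof, act_gof, act_gof]
    | hz => simp
    | ha x y hx hy => rw [map_add, map_add, mul_add, map_add, hx, hy, TensorProduct.map_add_right]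
    | hs c x hx => rw [map_smul, map_smul, mul_smul_comm, map_smul, hx, TensorProduct.map_smul_right]
  | hz => simp
  | ha x y hx hy => rw [map_add, map_add, add_mul, map_add, hx, hy, TensorProduct.map_add_left]
  | hs c x hx => rw [map_smul, map_smul, smul_mul_assoc, map_smul, hx, TensorProduct.map_smul_left]

/-- diagonal action of endomorphisms -/
noncomputable def DD (n : ℕ) (g : V →ₗ[ℂ] V) (h : W →ₗ[ℂ] W) : Module.End ℂ (TP n V ⊗[ℂ] TP n W) :=
  TensorProduct.map (tpow ℂ n g) (tpow ℂ n h)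

lemma DD_actB (g : V →ₗ[ℂ] V) (h : W →ₗ[ℂ] W) (x : BB n) :
    DD n g h ∘ₗ actB n V W x = actB n V W x ∘ₗ DD n g h := by
  induction x using ind_gof with
  | h0 σ =>
    obtain ⟨σ, τ⟩ := σ
    rw [actB_gof, DD, ← TensorProduct.map_comp, ← TensorProduct.map_comp, tpow_perm, tpow_perm]
  | hz => simp
  | ha x y hx hy => rw [map_add, LinearMap.comp_add, LinearMap.add_comp, hx, hy]
  | hs c x hx => rw [map_smul, LinearMap.comp_smul, LinearMap.smul_comp, hx]

/-- the shuffle map -/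
noncomputable def shuf (n : ℕ) (V W : Type) [AddCommGroup V] [Module ℂ V] [AddCommGroup W] [Module ℂ W] :
    TP n V ⊗[ℂ] TP n W →ₗ[ℂ] TP n (V ⊗[ℂ] W) :=
  TensorProduct.lift (PiTensorProduct.map₂ (fun _ => TensorProduct.mk ℂ V W))

lemma shuf_tprod (f : Fin n → V) (g : Fin n → W) :
    shuf n V W (PiTensorProduct.tprod ℂ f ⊗ₜ PiTensorProduct.tprod ℂ g) =
      PiTensorProduct.tprod ℂ (fun i => f i ⊗ₜ[ℂ] g i) := by
  rw [shuf, TensorProduct.lift.tmul, PiTensorProduct.map₂_tprod_tprod]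
  rfl

lemma shuf_bij : Function.Bijective (shuf n V W) := by
  let b := Module.Basis.ofVectorSpace ℂ V
  let c := Module.Basis.ofVectorSpace ℂ W
  let B1 := (Basis.piTensorProduct (fun _ : Fin n => b)).tensorProduct
    (Basis.piTensorProduct (fun _ : Fin n => c))
  let B2 := Basis.piTensorProduct (fun _ : Fin n => b.tensorProduct c)
  let θ := B1.equiv B2 (Equiv.arrowProdEquivProdArrow _ _ _).symm
  have : shuf n V W = θ.toLinearMap := by
    refine B1.ext fun p => ?_
    rw [LinearEquiv.coe_coe, Module.Basis.equiv_apply, Module.Basis.tensorProduct_apply]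
    simp only [B2, Basis.piTensorProduct_apply]
    rw [shuf_tprod]
    simp
  rw [this]
  exact θ.bijective

lemma ext2 {M : Type*} [AddCommGroup M] [Module ℂ M] {a b : TP n V ⊗[ℂ] TP n W →ₗ[ℂ] M}
    (h : ∀ f g, a (PiTensorProduct.tprod ℂ f ⊗ₜ PiTensorProduct.tprod ℂ g) =
      b (PiTensorProduct.tprod ℂ f ⊗ₜ PiTensorProduct.tprod ℂ g)) : a = b := by
  refine TensorProduct.ext ?_
  refine PiTensorProduct.ext (MultilinearMap.ext fun f => ?_)
  refine PiTensorProduct.ext (MultilinearMap.ext fun g => ?_)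
  exact h f g

lemma shuf_DD (g : V →ₗ[ℂ] V) (h : W →ₗ[ℂ] W) :
    shuf n V W ∘ₗ DD n g h = tpow ℂ n (TensorProduct.map g h) ∘ₗ shuf n V W := by
  refine ext2 fun f f' => ?_
  rw [LinearMap.comp_apply, LinearMap.comp_apply, shuf_tprod, DD, TensorProduct.map_tmul,
    tpow_tprod, tpow_tprod, shuf_tprod, tpow_tprod]
  rfl

lemma shuf_di (x : GA (Sn n)) :
    shuf n V W ∘ₗ actB n V W (diB x) = act n (V ⊗[ℂ] W) x ∘ₗ shuf n V W := by
  induction x using ind_gof with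
  | h0 σ =>
    rw [diB_gof, actB_gof, act_gof]
    refine ext2 fun f f' => ?_
    rw [LinearMap.comp_apply, LinearMap.comp_apply, shuf_tprod, TensorProduct.map_tmul,
      permAction_tprod, permAction_tprod, shuf_tprod, permAction_tprod]
  | hz => simp
  | ha x y hx hy => rw [map_add, map_add, map_add, LinearMap.comp_add, LinearMap.add_comp, hx, hy]
  | hs c x hx => rw [map_smul, map_smul, map_smul, LinearMap.comp_smul, LinearMap.smul_comp, hx]

/-- inclusion of the product of Schur modules -/
noncomputable def incl2 (l m : Partition') (hl : size l = n) (hm : size m = n) (V W : Type)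
    [AddCommGroup V] [Module ℂ V] [AddCommGroup W] [Module ℂ W] :
    (schur ℂ l V) ⊗[ℂ] (schur ℂ m W) →ₗ[ℂ] TP n V ⊗[ℂ] TP n W :=
  TensorProduct.map (incl l hl V) (incl m hm W)

lemma incl2_inj (l m : Partition') (hl : size l = n) (hm : size m = n) :
    Function.Injective (incl2 l m hl hm V W) :=
  TensorProduct.map_injective_of_flat_flat _ _ (incl_inj _ _) (incl_inj _ _)

lemma range_map_le {A A' C D D' F : Type*} [AddCommGroup A] [Module ℂ A] [AddCommGroup A'] [Module ℂ A']
    [AddCommGroup C] [Module ℂ C] [AddCommGroup D] [Module ℂ D] [AddCommGroup D'] [Module ℂ D']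
    [AddCommGroup F] [Module ℂ F] (f : A →ₗ[ℂ] C) (f' : A' →ₗ[ℂ] C) (g : D →ₗ[ℂ] F) (g' : D' →ₗ[ℂ] F)
    (h1 : LinearMap.range f ≤ LinearMap.range f') (h2 : LinearMap.range g ≤ LinearMap.range g') :
    LinearMap.range (TensorProduct.map f g) ≤ LinearMap.range (TensorProduct.map f' g') := by
  rw [TensorProduct.range_map_eq_span_tmul, Submodule.span_le]
  rintro _ ⟨a, d, rfl⟩
  obtain ⟨a', ha⟩ := h1 ⟨a, rfl⟩
  obtain ⟨d', hd⟩ := h2 ⟨d, rfl⟩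
  exact ⟨a' ⊗ₜ d', by rw [TensorProduct.map_tmul, ha, hd]⟩

lemma incl2_range (l m : Partition') (hl : size l = n) (hm : size m = n) :
    LinearMap.range (incl2 l m hl hm V W) =
      LinearMap.range (actB n V W (eps (⟨l, hl⟩, ⟨m, hm⟩))) := by
  rw [eps, actB_lr, incl2]
  exact le_antisymm (range_map_le _ _ _ _ (incl_range l hl).le (incl_range m hm).le)
    (range_map_le _ _ _ _ (incl_range l hl).ge (incl_range m hm).ge)

lemma incl2_DD (l m : Partition') (hl : size l = n) (hm : size m = n) (g : V →ₗ[ℂ] V)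
    (h : W →ₗ[ℂ] W) (hg) (hh) :
    DD n g h ∘ₗ incl2 l m hl hm V W = incl2 l m hl hm V W ∘ₗ
      TensorProduct.map ((tpow ℂ (size l) g).restrict hg) ((tpow ℂ (size m) h).restrict hh) := by
  rw [DD, incl2, ← TensorProduct.map_comp, ← TensorProduct.map_comp, incl_tpow l hl g hg,
    incl_tpow m hm h hh]

end Act
end KP

open scoped BigOperators
open scoped Classical
open scoped TensorProduct DirectSum
set_option linter.unusedSectionVars false

namespace KP
open Partition'

section Fin
variable (nu : Partition')

/-- index set -/
abbrev JJ := ((p : Partition' × Partition') × Fin (kron p.1 p.2 nu))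

/-- the partition as an element of PP -/
abbrev r0 : PP (size nu) := ⟨nu, rfl⟩

variable {nu}

lemma hs (j : JJ nu) : size j.1.1 = size nu ∧ size j.1.2 = size nu :=
  kron_ne (fun h => by
    have := j.2.2
    omega)

/-- the index -/
noncomputable def idx (j : JJ nu) : PP (size nu) × PP (size nu) :=
  (⟨j.1.1, (hs j).1⟩, ⟨j.1.2, (hs j).2⟩)

/-- basis of the multiplicity space -/
noncomputable def bas (k : PP (size nu) × PP (size nu)) :
    Module.Basis (Fin (Module.finrank ℂ (LinearMap.range (prj (r0 nu) k)))) ℂ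
      (LinearMap.range (prj (r0 nu) k)) := Module.finBasis ℂ _

lemma kron_idx (j : JJ nu) : kron j.1.1 j.1.2 nu =
    Module.finrank ℂ (LinearMap.range (prj (r0 nu) (idx j))) :=
  kron_eq j.1.1 j.1.2 nu (hs j).1 (hs j).2

/-- the vectors -/
noncomputable def wv (j : JJ nu) : BB (size nu) :=
  (bas (idx j) (Fin.cast (kron_idx j) j.2) : BB (size nu))

lemma wv_E (j : JJ nu) : diB (r0 nu).tab.e * wv j = wv j := by
  obtain ⟨y, hy⟩ := (bas (idx j) (Fin.cast (kron_idx j) j.2)).2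
  rw [wv, ← hy, prj_apply, ← mul_assoc, ← mul_assoc, di_idem]

lemma wv_eps (j : JJ nu) : wv j * eps (idx j) = wv j := by
  obtain ⟨y, hy⟩ := (bas (idx j) (Fin.cast (kron_idx j) j.2)).2
  rw [wv, ← hy, prj_apply, mul_assoc, eps_idem]

/-- the inverse indexing -/
noncomputable def ek (k : PP (size nu) × PP (size nu))
    (t : Fin (Module.finrank ℂ (LinearMap.range (prj (r0 nu) k)))) : JJ nu :=
  ⟨(k.1.1, k.2.1), Fin.cast (kron_eq k.1.1 k.2.1 nu k.1.2 k.2.2).symm t⟩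

lemma ek_idx (k : PP (size nu) × PP (size nu)) (t) : idx (ek k t) = k := rfl

lemma wv_ek (k : PP (size nu) × PP (size nu)) (t) : wv (ek k t) = bas k t := rfl

lemma ek_inj (k : PP (size nu) × PP (size nu)) : Function.Injective (ek k) := by
  intro s t h
  have := eq_of_heq (Sigma.mk.inj h).2
  exact Fin.cast_injective _ this

lemma ek_surj (j : JJ nu) : ∃ t, ek (idx j) t = j := ⟨Fin.cast (kron_idx j) j.2, rfl⟩

lemma wv_span (b : BB (size nu)) (k) :
    diB (r0 nu).tab.e * b * eps k ∈ Submodule.span ℂ (wv '' {j : JJ nu | idx j = k}) := by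
  let x : LinearMap.range (prj (r0 nu) k) := ⟨prj (r0 nu) k b, b, rfl⟩
  have hx : diB (r0 nu).tab.e * b * eps k = (x : BB (size nu)) := rfl
  rw [hx, ← (bas k).sum_repr x, Submodule.coe_sum]
  refine Submodule.sum_mem _ fun t _ => ?_
  rw [Submodule.coe_smul]
  refine Submodule.smul_mem _ _ (Submodule.subset_span ⟨ek k t, ek_idx k t, wv_ek k t⟩)

lemma wv_li (k : PP (size nu) × PP (size nu)) (s : Finset (JJ nu)) (a : JJ nu → ℂ)
    (ha : ∀ j, idx j ≠ k → a j = 0) (h : ∑ j ∈ s, a j • wv j = 0) : ∀ j ∈ s, a j = 0 := by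
  have h1 : ∑ t ∈ Finset.univ.filter (fun t => ek k t ∈ s), a (ek k t) • (bas k t : BB (size nu)) =
      ∑ j ∈ s, a j • wv j := by
    refine Finset.sum_of_injOn (ek k) ((ek_inj k).injOn) ?_ ?_ ?_
    · intro t ht
      simpa using ht
    · intro j hj hn
      by_cases hk : idx j = k
      · exfalso
        subst hk
        obtain ⟨t, ht⟩ := ek_surj j
        apply hn
        exact ⟨t, by simpa [ht] using hj, ht⟩
      · rw [ha j hk, zero_smul]
    · intro t _
      rw [wv_ek]
  rw [h] at h1
  have h2 : ∑ t ∈ Finset.univ.filter (fun t => ek k t ∈ s), a (ek k t) • bas k t = 0 := by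
    apply Subtype.ext
    rw [Submodule.coe_sum]
    exact h1
  have h3 := linearIndependent_iff'.1 (bas k).linearIndependent _ _ h2
  intro j hj
  by_cases hk : idx j = k
  · subst hk
    obtain ⟨t, ht⟩ := ek_surj j
    rw [← ht]
    exact h3 t (by simpa [ht] using hj)
  · exact ha j hk

variable (nu) (V W : Type) [AddCommGroup V] [Module ℂ V] [AddCommGroup W] [Module ℂ W]

/-- the summands -/
abbrev QQ (j : JJ nu) := (schur ℂ j.1.1 V) ⊗[ℂ] (schur ℂ j.1.2 W)

/-- inclusion -/
noncomputable def qq (j : JJ nu) : QQ nu V W j →ₗ[ℂ] TP (size nu) V ⊗[ℂ] TP (size nu) W :=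
  incl2 j.1.1 j.1.2 (hs j).1 (hs j).2 V W

/-- the total map -/
noncomputable def Phi : (⨁ j : JJ nu, QQ nu V W j) →ₗ[ℂ] TP (size nu) V ⊗[ℂ] TP (size nu) W :=
  DirectSum.toModule ℂ (JJ nu) _ (fun j => actB (size nu) V W (wv j) ∘ₗ qq nu V W j)

lemma qq_inj (j : JJ nu) : Function.Injective (qq nu V W j) := incl2_inj _ _ _ _

lemma qq_range (j : JJ nu) : LinearMap.range (qq nu V W j) =
    LinearMap.range (actB (size nu) V W (eps (idx j))) := incl2_range _ _ _ _

lemma Phi_inj : Function.Injective (Phi nu V W) := by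
  have key := gen_inj (actB (size nu) V W) (J := JJ nu) eps eps_idem
    (fun _ _ h x => eps_orth h x) eps_scal one_span idx wv wv_eps wv_li (Q := QQ nu V W)
  have key2 := key (qq nu V W)
  have key3 := key2 (qq_inj nu V W)
  have key4 := key3 (qq_range nu V W)
  rw [Phi]
  exact key4

lemma Phi_range : LinearMap.range (Phi nu V W) =
    LinearMap.range (actB (size nu) V W (diB (r0 nu).tab.e)) := by
  have key := gen_range (actB (size nu) V W) (J := JJ nu) eps eps_idem one_span
    (diB (r0 nu).tab.e) idx wv wv_E wv_eps wv_span (Q := QQ nu V W)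
  have key2 := key (qq nu V W)
  have key3 := key2 (qq_range nu V W)
  rw [Phi]
  exact key3

/-- the map to the tensor power -/
noncomputable def Psi : (⨁ j : JJ nu, QQ nu V W j) →ₗ[ℂ] TP (size nu) (V ⊗[ℂ] W) :=
  shuf (size nu) V W ∘ₗ Phi nu V W

lemma Psi_inj : Function.Injective (Psi nu V W) := by
  rw [Psi, LinearMap.coe_comp]
  exact shuf_bij.1.comp (Phi_inj nu V W)

lemma Psi_range : LinearMap.range (Psi nu V W) = schur ℂ nu (V ⊗[ℂ] W) := by
  rw [Psi, LinearMap.range_comp, Phi_range, ← LinearMap.range_comp, shuf_di, LinearMap.range_comp,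
    LinearMap.range_eq_top.2 shuf_bij.2, Submodule.map_top, schur_eq]

lemma Psi_lof (j : JJ nu) (z : QQ nu V W j) (g : V →ₗ[ℂ] V) (h : W →ₗ[ℂ] W) (hg) (hh) :
    tpow ℂ (size nu) (TensorProduct.map g h) (Psi nu V W (DirectSum.lof ℂ (JJ nu) (QQ nu V W) j z)) =
      Psi nu V W (DirectSum.lof ℂ (JJ nu) (QQ nu V W) j
        (TensorProduct.map ((tpow ℂ (size j.1.1) g).restrict hg)
          ((tpow ℂ (size j.1.2) h).restrict hh) z)) := by
  rw [Psi, LinearMap.comp_apply, LinearMap.comp_apply, ← LinearMap.comp_apply, ← shuf_DD,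
    LinearMap.comp_apply]
  congr 1
  rw [Phi, DirectSum.toModule_lof, DirectSum.toModule_lof, LinearMap.comp_apply,
    LinearMap.comp_apply, ← LinearMap.comp_apply, DD_actB, LinearMap.comp_apply]
  congr 1
  exact LinearMap.congr_fun (incl2_DD j.1.1 j.1.2 (hs j).1 (hs j).2 g h hg hh) z

/-- the equivalence -/
noncomputable def ee : (⨁ j : JJ nu, QQ nu V W j) ≃ₗ[ℂ] schur ℂ nu (V ⊗[ℂ] W) :=
  (LinearEquiv.ofInjective (Psi nu V W) (Psi_inj nu V W)).trans
    (LinearEquiv.ofEq _ _ (Psi_range nu V W))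

lemma ee_coe (x) : (ee nu V W x : TP (size nu) (V ⊗[ℂ] W)) = Psi nu V W x := rfl

end Fin
end KP

open Partition' in
/-- for finite dimensional complex vector spaces `V₁, V₂` and a partition `ν`
of length at most `dim V₁ · dim V₂`, the Schur module `S^ν(V₁ ⊗ V₂)` — which is invariant
under the natural action of `GL(V₁) × GL(V₂)` on the `|ν|`-th tensor power of `V₁ ⊗ V₂` —
decomposes `GL(V₁) × GL(V₂)`-equivariantly as
`⊕_{λ,μ} (S^λ V₁ ⊗ S^μ V₂)^{⊕ g_{λ,μ,ν}}`, where `g` are the Kronecker coefficients. -/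
theorem schurModule_tensor_decomposition (V₁ V₂ : Type) [AddCommGroup V₁] [Module ℂ V₁]
    [AddCommGroup V₂] [Module ℂ V₂] [FiniteDimensional ℂ V₁] [FiniteDimensional ℂ V₂]
    (nu : Partition')
    (hlen : plength nu ≤ Module.finrank ℂ V₁ * Module.finrank ℂ V₂) :
    ∃ (hinv : ∀ (g₁ : V₁ ≃ₗ[ℂ] V₁) (g₂ : V₂ ≃ₗ[ℂ] V₂),
        ∀ x ∈ schur ℂ nu (V₁ ⊗[ℂ] V₂),
          tpow ℂ (size nu) (TensorProduct.map g₁.toLinearMap g₂.toLinearMap) x ∈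
            schur ℂ nu (V₁ ⊗[ℂ] V₂))
      (hinv₁ : ∀ (l : Partition') (g₁ : V₁ ≃ₗ[ℂ] V₁),
        ∀ x ∈ schur ℂ l V₁, tpow ℂ (size l) g₁.toLinearMap x ∈ schur ℂ l V₁)
      (hinv₂ : ∀ (m : Partition') (g₂ : V₂ ≃ₗ[ℂ] V₂),
        ∀ x ∈ schur ℂ m V₂, tpow ℂ (size m) g₂.toLinearMap x ∈ schur ℂ m V₂)
      (e : schur ℂ nu (V₁ ⊗[ℂ] V₂) ≃ₗ[ℂ]
        ⨁ (i : ((p : Partition' × Partition') × Fin (kron p.1 p.2 nu))),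
          ((schur ℂ i.1.1 V₁) ⊗[ℂ] (schur ℂ i.1.2 V₂))),
      ∀ (g₁ : V₁ ≃ₗ[ℂ] V₁) (g₂ : V₂ ≃ₗ[ℂ] V₂),
        e.toLinearMap ∘ₗ
            (tpow ℂ (size nu) (TensorProduct.map g₁.toLinearMap g₂.toLinearMap)).restrict
              (hinv g₁ g₂) =
          (DirectSum.toModule ℂ _ _ fun i =>
            (DirectSum.lof ℂ _
                (fun i : ((p : Partition' × Partition') × Fin (kron p.1 p.2 nu)) =>
                  ((schur ℂ i.1.1 V₁) ⊗[ℂ] (schur ℂ i.1.2 V₂))) i) ∘ₗ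
              TensorProduct.map
                ((tpow ℂ (size i.1.1) g₁.toLinearMap).restrict (hinv₁ i.1.1 g₁))
                ((tpow ℂ (size i.1.2) g₂.toLinearMap).restrict (hinv₂ i.1.2 g₂))) ∘ₗ
            e.toLinearMap := by
  refine ⟨fun g₁ g₂ => KP.schur_inv nu _, fun l g₁ => KP.schur_inv l _,
    fun m g₂ => KP.schur_inv m _, (KP.ee nu V₁ V₂).symm, fun g₁ g₂ => ?_⟩
  refine LinearMap.ext fun x => ?_
  obtain ⟨y, rfl⟩ := (KP.ee nu V₁ V₂).surjective x
  simp only [LinearMap.comp_apply, LinearEquiv.coe_coe, LinearEquiv.symm_apply_apply]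
  rw [LinearEquiv.symm_apply_eq]
  induction y using DirectSum.induction_on with
  | zero => simp
  | of j z =>
    rw [← DirectSum.lof_eq_of ℂ, DirectSum.toModule_lof]
    apply Subtype.ext
    rw [LinearMap.coe_restrict_apply, KP.ee_coe, KP.ee_coe]
    exact KP.Psi_lof nu V₁ V₂ j z _ _ _ _
  | add x y hx hy =>
    rw [map_add, map_add, hx, hy, map_add, map_add]
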